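/- None of Q-res, QU-res, IR-calc, or IR-calc^{σ_v} polynomially simulates tree R1 + Sk: for each of these QBF systems P, there is no polynomial q such that whenever a false closed PCNF Φ has a tree R1 refutation of Sk(Φ) ∪ {p(f₁), ¬p(f₀)} of size s, Φ has a P-refutation of size at most q(s). -/

import Mathlib

/-! ## Propositional / QBF side -/

inductive Lit where
  | pos (x : ℕ)
  | neg (x : ℕ)
deriving DecidableEq

def Lit.var : Lit → ℕ
  | pos x => x
  | neg x => x

def Lit.isPos : Lit → Bool
  | pos _ => true
  | neg _ => false

def Lit.negate : Lit → Lit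
  | pos x => neg x
  | neg x => pos x

def Lit.eval (v : ℕ → Bool) : Lit → Bool
  | pos x => v x
  | neg x => !(v x)

abbrev Clause := Finset Lit

def Clause.Taut (C : Clause) : Prop := ∃ x, Lit.pos x ∈ C ∧ Lit.neg x ∈ C

/-- A prenex CNF: a list of quantifier blocks (`true` = existential,
`false` = universal), each with an ordered list of variables, and a matrix
which is a finite set of clauses. -/
structure PCNF where
  blocks : List (Bool × List ℕ)
  matrix : Finset Clause

def PCNF.allVars (Φ : PCNF) : List ℕ := Φ.blocks.flatMap (·.2)

/-- Well-formedness: quantifier blocks alternate and the blocks are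
pairwise disjoint sets of variables (no repetitions). -/
def PCNF.WF (Φ : PCNF) : Prop :=
  List.Chain' (fun a b => a.1 ≠ b.1) Φ.blocks ∧ Φ.allVars.Nodup ∧
    ∀ b ∈ Φ.blocks, b.2 ≠ []

/-- Closedness: every variable of the matrix is quantified in the prefix. -/
def PCNF.Closed (Φ : PCNF) : Prop :=
  ∀ C ∈ Φ.matrix, ∀ l ∈ C, l.var ∈ Φ.allVars

def PCNF.existB (Φ : PCNF) (x : ℕ) : Bool :=
  Φ.blocks.any fun b => b.1 && b.2.contains x

def PCNF.univB (Φ : PCNF) (x : ℕ) : Bool :=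
  Φ.blocks.any fun b => !b.1 && b.2.contains x

/-- The level of a variable: the index of its quantifier block. -/
def PCNF.lv (Φ : PCNF) (x : ℕ) : ℕ :=
  Φ.blocks.findIdx fun b => b.2.contains x

def evalClause (v : ℕ → Bool) (C : Clause) : Prop := ∃ l ∈ C, l.eval v = true

/-- Standard QBF semantics of a prenex CNF, evaluated block by block. -/
def truthAux (M : Finset Clause) : List (Bool × List ℕ) → (ℕ → Bool) → Prop
  | [], v => ∀ C ∈ M, evalClause v C
  | (q, xs) :: rest, v =>
      if q then ∃ w : ℕ → Bool, (∀ y, y ∉ xs → w y = v y) ∧ truthAux M rest w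
      else ∀ w : ℕ → Bool, (∀ y, y ∉ xs → w y = v y) → truthAux M rest w

def PCNF.IsTrue (Φ : PCNF) : Prop := truthAux Φ.matrix Φ.blocks fun _ => false

/-! ## Q-resolution and QU-resolution -/

/-- One derivation step of Q-res (`univPivot = false`) resp. QU-res
(`univPivot = true`) from the clauses derived so far. -/
inductive QStep (Φ : PCNF) (univPivot : Bool) (prev : List Clause) : Clause → Prop
  | ax (C : Clause) (hC : C ∈ Φ.matrix) (hnt : ¬ C.Taut) : QStep Φ univPivot prev C
  | res (x : ℕ) (A B : Clause) (hA : A ∈ prev) (hB : B ∈ prev)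
      (hxa : Lit.pos x ∈ A) (hxb : Lit.neg x ∈ B)
      (hpiv : Φ.existB x = true ∨ (univPivot = true ∧ Φ.univB x = true))
      (hblock : ∀ l ∈ A.erase (Lit.pos x), l.negate ∉ B.erase (Lit.neg x)) :
      QStep Φ univPivot prev ((A.erase (Lit.pos x)) ∪ (B.erase (Lit.neg x)))
  | fac (A : Clause) (hA : A ∈ prev) : QStep Φ univPivot prev A
  | univRed (A : Clause) (m : Lit) (hA : A ∈ prev) (hm : m ∈ A)
      (hu : Φ.univB m.var = true)
      (hlv : ∀ l ∈ A.erase m, Φ.existB l.var = true → Φ.lv l.var < Φ.lv m.var) :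
      QStep Φ univPivot prev (A.erase m)

def QValid (Φ : PCNF) (univPivot : Bool) (π : List Clause) : Prop :=
  ∀ i < π.length, QStep Φ univPivot (π.take i) π[i]!

def QRefutation (Φ : PCNF) (univPivot : Bool) (π : List Clause) : Prop :=
  QValid Φ univPivot π ∧ π ≠ [] ∧ π.getLast! = (∅ : Clause)

/-- Size of a (QBF) resolution derivation: total number of literal
occurrences in its clauses. -/
def qSize (π : List Clause) : ℕ := (π.map Finset.card).sum

/-! ## First-order terms, atoms, literals, clauses -/

inductive FTerm where
  | var (x : ℕ)
  | app (f : ℕ) (args : List FTerm)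

noncomputable instance : DecidableEq FTerm := Classical.decEq _

def FTerm.subst (σ : ℕ → FTerm) : FTerm → FTerm
  | .var x => σ x
  | .app f args => .app f (args.attach.map fun t => t.1.subst σ)
decreasing_by
  have := List.sizeOf_lt_of_mem t.2
  simp only [FTerm.app.sizeOf_spec]; omega

def FTerm.symSize : FTerm → ℕ
  | .var _ => 1
  | .app _ args => 1 + (args.attach.map fun t => t.1.symSize).sum
decreasing_by
  have := List.sizeOf_lt_of_mem t.2
  simp only [FTerm.app.sizeOf_spec]; omega

def FTerm.vars : FTerm → Finset ℕ
  | .var x => {x}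
  | .app _ args => (args.attach.map fun t => t.1.vars).foldr (· ∪ ·) ∅
decreasing_by
  have := List.sizeOf_lt_of_mem t.2
  simp only [FTerm.app.sizeOf_spec]; omega

/-- An atom `p(t₁,…,t_k)`: predicate symbol together with argument list. -/
structure FAtom where
  p : ℕ
  args : List FTerm

noncomputable instance : DecidableEq FAtom := Classical.decEq _

def FAtom.subst (σ : ℕ → FTerm) (a : FAtom) : FAtom := ⟨a.p, a.args.map (FTerm.subst σ)⟩
def FAtom.symSize (a : FAtom) : ℕ := 1 + (a.args.map FTerm.symSize).sum
def FAtom.vars (a : FAtom) : Finset ℕ := (a.args.map FTerm.vars).foldr (· ∪ ·) ∅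

inductive FLit where
  | pos (a : FAtom)
  | neg (a : FAtom)

noncomputable instance : DecidableEq FLit := Classical.decEq _

def FLit.atom : FLit → FAtom
  | pos a => a
  | neg a => a

def FLit.isPos : FLit → Bool
  | pos _ => true
  | neg _ => false

def FLit.subst (σ : ℕ → FTerm) : FLit → FLit
  | pos a => pos (a.subst σ)
  | neg a => neg (a.subst σ)

def FLit.symSize (l : FLit) : ℕ :=
  match l with
  | .pos a => a.symSize
  | .neg a => 1 + a.symSize

abbrev FClause := Finset FLit

noncomputable def FClause.subst (σ : ℕ → FTerm) (C : FClause) : FClause :=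
  C.image (FLit.subst σ)

noncomputable def FClause.symSize (C : FClause) : ℕ := ∑ l ∈ C, l.symSize

noncomputable def FClause.fvars (C : FClause) : Finset ℕ := C.sup fun l => l.atom.vars

/-! ## First-order resolution R1 -/

def compSub (σ μ : ℕ → FTerm) : ℕ → FTerm := fun x => (σ x).subst μ

def Unifies (σ : ℕ → FTerm) (a b : FAtom) : Prop := a.subst σ = b.subst σ

def IsMGU (σ : ℕ → FTerm) (a b : FAtom) : Prop :=
  Unifies σ a b ∧ ∀ τ, Unifies τ a b → ∃ μ, ∀ x, compSub σ μ x = τ x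

/-- `D` is a factor of `C`: `D = Cσ` for `σ` an mgu of two distinct
same-sign literals of `C`. -/
def IsFactor (C D : FClause) : Prop :=
  ∃ K L σ, K ∈ C ∧ L ∈ C ∧ K ≠ L ∧ K.isPos = L.isPos ∧
    IsMGU σ K.atom L.atom ∧ D = C.subst σ

def renameSub (ρ : ℕ → ℕ) : ℕ → FTerm := fun x => .var (ρ x)

/-- `E` is a resolvent of `C` and `D`. -/
def IsResolvent (C D E : FClause) : Prop :=
  ∃ ρ : ℕ → ℕ, Function.Injective ρ ∧
    ∃ K L σ, Disjoint C.fvars (FClause.subst (renameSub ρ) D).fvars ∧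
      K ∈ C ∧ L ∈ FClause.subst (renameSub ρ) D ∧ K.isPos = !L.isPos ∧
      IsMGU σ K.atom L.atom ∧
      E = ((C.subst σ).erase (K.subst σ)) ∪
          (((FClause.subst (renameSub ρ) D).subst σ).erase (L.subst σ))

def R1Valid (S : Set FClause) (π : List FClause) : Prop :=
  ∀ i < π.length,
    π[i]! ∈ S ∨ (∃ j < i, IsFactor π[j]! π[i]!) ∨
      (∃ j < i, ∃ k < i, IsResolvent π[j]! π[k]! π[i]!)

def R1Refutation (S : Set FClause) (π : List FClause) : Prop :=
  R1Valid S π ∧ π ≠ [] ∧ π.getLast! = (∅ : FClause)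

noncomputable def r1Size (π : List FClause) : ℕ := (π.map FClause.symSize).sum

/-- Tree-form R1 refutations: every clause occurrence is used at most once
as a premise, which is inherent in a tree-structured derivation. -/
inductive R1Tree (S : Set FClause) : FClause → Type
  | input (C : FClause) (h : C ∈ S) : R1Tree S C
  | factor {C : FClause} (t : R1Tree S C) (D : FClause) (h : IsFactor C D) : R1Tree S D
  | resolve {C D : FClause} (t₁ : R1Tree S C) (t₂ : R1Tree S D) (E : FClause)
      (h : IsResolvent C D E) : R1Tree S E

noncomputable def R1Tree.size {S : Set FClause} : {C : FClause} → R1Tree S C → ℕ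
  | C, .input _ _ => C.symSize
  | D, .factor t _ _ => t.size + D.symSize
  | E, .resolve t₁ t₂ _ _ => t₁.size + t₂.size + E.symSize

def R1Tree.clauseCount {S : Set FClause} : {C : FClause} → R1Tree S C → ℕ
  | _, .input _ _ => 1
  | _, .factor t _ _ => t.clauseCount + 1
  | _, .resolve t₁ t₂ _ _ => t₁.clauseCount + t₂.clauseCount + 1

/-! ## The Skolem and EPR translations -/

/-- The universal variables strictly preceding `a` in the prefix,
in prefix order. -/
def PCNF.univBefore (Φ : PCNF) (a : ℕ) : List ℕ :=
  ((Φ.blocks.flatMap fun b => b.2.map fun x => (b.1, x)).takeWhile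
      fun p => p.2 ≠ a).filterMap
    fun p => if p.1 = false then some p.2 else none

/-- `p` is the predicate symbol `0`; `f₀`, `f₁` are the constants `0`, `1`;
the Skolem function symbol for existential variable `a` is `a + 2`. -/
def skAtom (Φ : PCNF) (x : ℕ) : FAtom :=
  if Φ.existB x then ⟨0, [FTerm.app (x + 2) ((Φ.univBefore x).map FTerm.var)]⟩
  else ⟨0, [FTerm.var x]⟩

def skLit (Φ : PCNF) : Lit → FLit
  | .pos x => .pos (skAtom Φ x)
  | .neg x => .neg (skAtom Φ x)

noncomputable def skClause (Φ : PCNF) (C : Clause) : FClause := C.image (skLit Φ)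

def pf1Cl : FClause := {FLit.pos ⟨0, [FTerm.app 1 []]⟩}
def npf0Cl : FClause := {FLit.neg ⟨0, [FTerm.app 0 []]⟩}

/-- The clause set `Sk(Φ) ∪ {p(f₁), ¬p(f₀)}`. -/
noncomputable def skSet (Φ : PCNF) : Set FClause :=
  ↑(Φ.matrix.image (skClause Φ)) ∪ {pf1Cl, npf0Cl}

/-- EPR atom: `p(f_a(u₁,…,u_k))` with `k ≥ 1` becomes `p_a(u₁,…,u_k)`,
where the fresh predicate symbol `p_a` is `a + 1`. -/
def eprAtom (Φ : PCNF) (x : ℕ) : FAtom :=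
  if Φ.existB x then
    if Φ.univBefore x = [] then ⟨0, [FTerm.app (x + 2) []]⟩
    else ⟨x + 1, (Φ.univBefore x).map FTerm.var⟩
  else ⟨0, [FTerm.var x]⟩

def eprLit (Φ : PCNF) : Lit → FLit
  | .pos x => .pos (eprAtom Φ x)
  | .neg x => .neg (eprAtom Φ x)

noncomputable def eprClause (Φ : PCNF) (C : Clause) : FClause := C.image (eprLit Φ)

/-- The clause set `EPR(Φ) ∪ {p(f₁), ¬p(f₀)}`. -/
noncomputable def eprSet (Φ : PCNF) : Set FClause :=
  ↑(Φ.matrix.image (eprClause Φ)) ∪ {pf1Cl, npf0Cl}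

/-! ## IR-calc and its extensions -/

/-- An annotation: a (functional) finite set of assignments
`universal variable ↦ 0/1` (`false` = 0, `true` = 1). -/
abbrev Ann := Finset (ℕ × Bool)

def Ann.Functional (τ : Ann) : Prop := ∀ x b b', (x, b) ∈ τ → (x, b') ∈ τ → b = b'

/-- Restriction `[σ]` of an annotation to the universal variables of level
below the level of the literal `l`. -/
def annRestr (Φ : PCNF) (σ : Ann) (l : Lit) : Ann :=
  σ.filter fun p => Φ.lv p.1 < Φ.lv l.var

/-- Completion of `μ` by `τ`. -/
def annCompl (μ τ : Ann) : Ann :=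
  μ ∪ τ.filter fun p => p.1 ∉ μ.image Prod.fst

structure ALit where
  lit : Lit
  ann : Ann
deriving DecidableEq

abbrev AClause := Finset ALit

def ALit.symSize (al : ALit) : ℕ := 1 + 2 * al.ann.card
def AClause.symSize (A : AClause) : ℕ := ∑ al ∈ A, al.symSize
def aSize (π : List AClause) : ℕ := (π.map AClause.symSize).sum

/-- The annotation extracted from the universal literals of a clause:
`u ↦ 0` for positive and `u ↦ 1` for negative universal literals. -/
def axAnn (Φ : PCNF) (C : Clause) : Ann :=
  (C.filter fun l => Φ.univB l.var).image fun l =>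
    match l with
    | .pos u => (u, false)
    | .neg u => (u, true)

/-- The axiom clause of IR-calc obtained from a matrix clause. -/
def axClause (Φ : PCNF) (C : Clause) : AClause :=
  (C.filter fun l => Φ.existB l.var).image fun l => ⟨l, annRestr Φ (axAnn Φ C) l⟩

/-- Application of a variable substitution `σ_v` (universal ↦ existential)
to a literal. -/
def applySigv (σv : ℕ → Option ℕ) : Lit → Lit
  | .pos x => match σv x with | some e => .pos e | none => .pos x
  | .neg x => match σv x with | some e => .neg e | none => .neg x

def Clause.applySigv (σv : ℕ → Option ℕ) (C : Clause) : Clause :=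
  C.image (_root_.applySigv σv)

/-- Admissibility of `σ_v`: it maps universal variables to existential
variables of strictly smaller level. -/
def Admissible (Φ : PCNF) (σv : ℕ → Option ℕ) : Prop :=
  ∀ x e, σv x = some e → Φ.univB x = true ∧ Φ.existB e = true ∧ Φ.lv e < Φ.lv x

/-- One step of IR-calc(P, M, Δ, σ_v).  Plain IR-calc is the instance with
`Δ = ∅` and `σv = fun _ => none`; IR-calc^{σ_v} the instance with `Δ = ∅`. -/
inductive IRStep (Φ : PCNF) (Δ : Finset Clause) (σv : ℕ → Option ℕ)
    (prev : List AClause) : AClause → Prop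
  | ax (C : Clause) (hC : C ∈ Φ.matrix) (hnt : ¬ C.Taut)
      (hnt' : ¬ (C.applySigv σv).Taut) :
      IRStep Φ Δ σv prev (axClause Φ (C.applySigv σv))
  | axExt (C : Clause) (hC : C ∈ Δ) (hnt : ¬ C.Taut) :
      IRStep Φ Δ σv prev (C.image fun l => ⟨l, ∅⟩)
  | res (x : ℕ) (τ : Ann) (A B : AClause) (hA : A ∈ prev) (hB : B ∈ prev)
      (hxa : (⟨Lit.pos x, τ⟩ : ALit) ∈ A) (hxb : (⟨Lit.neg x, τ⟩ : ALit) ∈ B) :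
      IRStep Φ Δ σv prev ((A.erase ⟨Lit.pos x, τ⟩) ∪ (B.erase ⟨Lit.neg x, τ⟩))
  | fac (A : AClause) (hA : A ∈ prev) : IRStep Φ Δ σv prev A
  | inst (A : AClause) (τ : Ann) (hA : A ∈ prev) (hfun : τ.Functional)
      (hdom : ∀ p ∈ τ, Φ.univB p.1 = true) :
      IRStep Φ Δ σv prev
        (A.image fun al => ⟨al.lit, annRestr Φ (annCompl al.ann τ) al.lit⟩)

def IRValid (Φ : PCNF) (Δ : Finset Clause) (σv : ℕ → Option ℕ)
    (π : List AClause) : Prop :=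
  ∀ i < π.length, IRStep Φ Δ σv (π.take i) π[i]!

def IRRefutation (Φ : PCNF) (Δ : Finset Clause) (σv : ℕ → Option ℕ)
    (π : List AClause) : Prop :=
  IRValid Φ Δ σv π ∧ π ≠ [] ∧ π.getLast! = (∅ : AClause)

def noSub : ℕ → Option ℕ := fun _ => none

/-- Tree-form IR-calc(P, M, Δ, σ_v) derivations. -/
inductive IRTree (Φ : PCNF) (Δ : Finset Clause) (σv : ℕ → Option ℕ) : AClause → Type
  | ax (C : Clause) (hC : C ∈ Φ.matrix) (hnt : ¬ C.Taut)
      (hnt' : ¬ (C.applySigv σv).Taut) : IRTree Φ Δ σv (axClause Φ (C.applySigv σv))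
  | axExt (C : Clause) (hC : C ∈ Δ) (hnt : ¬ C.Taut) :
      IRTree Φ Δ σv (C.image fun l => ⟨l, ∅⟩)
  | res {A B : AClause} (t₁ : IRTree Φ Δ σv A) (t₂ : IRTree Φ Δ σv B)
      (x : ℕ) (τ : Ann)
      (hxa : (⟨Lit.pos x, τ⟩ : ALit) ∈ A) (hxb : (⟨Lit.neg x, τ⟩ : ALit) ∈ B) :
      IRTree Φ Δ σv ((A.erase ⟨Lit.pos x, τ⟩) ∪ (B.erase ⟨Lit.neg x, τ⟩))
  | inst {A : AClause} (t : IRTree Φ Δ σv A) (τ : Ann) (hfun : τ.Functional)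
      (hdom : ∀ p ∈ τ, Φ.univB p.1 = true) :
      IRTree Φ Δ σv (A.image fun al => ⟨al.lit, annRestr Φ (annCompl al.ann τ) al.lit⟩)

def IRTree.size {Φ : PCNF} {Δ : Finset Clause} {σv : ℕ → Option ℕ} :
    {A : AClause} → IRTree Φ Δ σv A → ℕ
  | _, .ax C _ _ _ => AClause.symSize (axClause Φ (C.applySigv σv))
  | _, .axExt C _ _ => AClause.symSize (C.image fun l => (⟨l, ∅⟩ : ALit))
  | _, .res (A := A) (B := B) t₁ t₂ x τ _ _ =>
      t₁.size + t₂.size +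
        AClause.symSize ((A.erase ⟨Lit.pos x, τ⟩) ∪ (B.erase ⟨Lit.neg x, τ⟩))
  | _, .inst (A := A) t τ _ _ =>
      t.size + AClause.symSize (A.image fun al =>
        (⟨al.lit, annRestr Φ (annCompl al.ann τ) al.lit⟩ : ALit))

/-! ## The formula families Φ_n and Ω_n (pigeonhole based) -/

def xv (i j : ℕ) : ℕ := Nat.pair 0 (Nat.pair i (Nat.pair j 0))
def yv (i j : ℕ) : ℕ := Nat.pair 1 (Nat.pair i (Nat.pair j 0))
def zv (i₁ i₂ j : ℕ) : ℕ := Nat.pair 2 (Nat.pair i₁ (Nat.pair i₂ j))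

def Xlist (n : ℕ) : List ℕ :=
  (List.range (n+1)).flatMap fun i => (List.range n).map fun j => xv (i+1) (j+1)
def Ylist (n : ℕ) : List ℕ :=
  (List.range (n+1)).flatMap fun i => (List.range n).map fun j => yv (i+1) (j+1)
def Zlist (n : ℕ) : List ℕ :=
  ((List.range (n+1)).map fun i => zv (i+1) 0 0) ++
  ((List.range n).flatMap fun j => (List.range (n+1)).flatMap fun i₁ =>
    (List.range (n+1)).filterMap fun i₂ =>
      if i₁ < i₂ then some (zv (i₁+1) (i₂+1) (j+1)) else none)

/-- The clauses of PHP_n(X_n). -/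
def PHPcls (n : ℕ) : Finset Clause :=
  ((List.range (n+1)).map fun i =>
      (((List.range n).map fun j => Lit.pos (xv (i+1) (j+1))).toFinset : Clause)).toFinset ∪
  ((List.range n).flatMap fun j => (List.range (n+1)).flatMap fun i₁ =>
    (List.range (n+1)).filterMap fun i₂ =>
      if i₁ < i₂ then
        some ({Lit.neg (xv (i₁+1) (j+1)), Lit.neg (xv (i₂+1) (j+1))} : Clause)
      else none).toFinset

/-- The clauses of TPHP′_n(Y_n, Z_n). -/
def TPHPcls (n : ℕ) : Finset Clause :=
  {(((Zlist n).map Lit.neg).toFinset : Clause)} ∪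
  ((List.range (n+1)).flatMap fun i => (List.range n).map fun j =>
      ({Lit.pos (zv (i+1) 0 0), Lit.neg (yv (i+1) (j+1))} : Clause)).toFinset ∪
  ((List.range n).flatMap fun j => (List.range (n+1)).flatMap fun i₁ =>
    (List.range (n+1)).flatMap fun i₂ =>
      if i₁ < i₂ then
        [({Lit.pos (zv (i₁+1) (i₂+1) (j+1)), Lit.pos (yv (i₁+1) (j+1))} : Clause),
         ({Lit.pos (zv (i₁+1) (i₂+1) (j+1)), Lit.pos (yv (i₂+1) (j+1))} : Clause)]
      else []).toFinset

def phiMatrix (n : ℕ) : Finset Clause := TPHPcls n ∪ PHPcls n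

/-- Φ_n = ∃X_n ∀Y_n ∃Z_n (TPHP′_n ∧ PHP_n). -/
def PhiF (n : ℕ) : PCNF :=
  ⟨[(true, Xlist n), (false, Ylist n), (true, Zlist n)], phiMatrix n⟩

/-- Ω_n = ∀Y_n ∃Z_n ∃X_n (TPHP′_n ∧ PHP_n) (Z_n and X_n form one block). -/
def OmegaF (n : ℕ) : PCNF :=
  ⟨[(false, Ylist n), (true, Zlist n ++ Xlist n)], phiMatrix n⟩

/-! ## The formula family Ψ_t of Kleine Büning, Karpinski and Flögel -/

def dv (j : ℕ) : ℕ := 5*j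
def ev (j : ℕ) : ℕ := 5*j+1
def xvv (j : ℕ) : ℕ := 5*j+2
def fv (j : ℕ) : ℕ := 5*j+3
def qv (j : ℕ) : ℕ := 5*j+4

/-- The prefix P_t; if `withQ` is set, the fresh extension variable `q_i`
is placed in the same existential block as `d_i` and `e_i`. -/
def psiPrefix (t : ℕ) (withQ : Bool) : List (Bool × List ℕ) :=
  ((true, [dv 0, dv 1, ev 1] ++ if withQ then [qv 1] else []) ::
    (List.range (t-1)).flatMap fun j =>
      [(false, [xvv (j+1)]),
       (true, [dv (j+2), ev (j+2)] ++ if withQ then [qv (j+2)] else [])]) ++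
  [(false, [xvv t]), (true, (List.range t).map fun i => fv (i+1))]

def fNegs (t : ℕ) : List Lit := (List.range t).map fun i => Lit.neg (fv (i+1))

def psiMatrix (t : ℕ) : Finset Clause :=
  ({({Lit.neg (dv 0)} : Clause),
    ({Lit.pos (dv 0), Lit.neg (dv 1), Lit.neg (ev 1)} : Clause),
    (((Lit.pos (dv t) :: Lit.neg (xvv t) :: fNegs t).toFinset : Clause)),
    (((Lit.pos (ev t) :: Lit.pos (xvv t) :: fNegs t).toFinset : Clause))} : Finset Clause) ∪
  ((List.range (t-1)).flatMap fun j =>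
     [({Lit.pos (dv (j+1)), Lit.neg (xvv (j+1)), Lit.neg (dv (j+2)), Lit.neg (ev (j+2))} : Clause),
      ({Lit.pos (ev (j+1)), Lit.pos (xvv (j+1)), Lit.neg (dv (j+2)), Lit.neg (ev (j+2))} : Clause)]).toFinset ∪
  ((List.range t).flatMap fun j =>
     [({Lit.neg (xvv (j+1)), Lit.pos (fv (j+1))} : Clause),
      ({Lit.pos (xvv (j+1)), Lit.pos (fv (j+1))} : Clause)]).toFinset

def PsiF (t : ℕ) : PCNF := ⟨psiPrefix t false, psiMatrix t⟩

/-- Ψ_t with the extension variables q_i added to the prefix. -/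
def PsiFq (t : ℕ) : PCNF := ⟨psiPrefix t true, psiMatrix t⟩

/-- The extension clauses Δ: clausal form of q_i ↔ (¬d_i ∧ e_i), 1 ≤ i ≤ t. -/
def DeltaT (t : ℕ) : Finset Clause :=
  ((List.range t).flatMap fun i =>
    [({Lit.pos (qv (i+1)), Lit.pos (dv (i+1)), Lit.neg (ev (i+1))} : Clause),
     ({Lit.neg (qv (i+1)), Lit.neg (dv (i+1))} : Clause),
     ({Lit.neg (qv (i+1)), Lit.pos (ev (i+1))} : Clause)]).toFinset

/-- σ_{v,t} = { x_i ↦ q_i : 1 ≤ i ≤ t }. -/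
def sigmaQv (t : ℕ) : ℕ → Option ℕ := fun v =>
  if v % 5 = 2 ∧ 1 ≤ v / 5 ∧ v / 5 ≤ t then some (5 * (v / 5) + 4) else none

/-- σ_{v,t} = { x_i ↦ e_i : 1 ≤ i ≤ t }. -/
def sigmaEv (t : ℕ) : ℕ → Option ℕ := fun v =>
  if v % 5 = 2 ∧ 1 ≤ v / 5 ∧ v / 5 ≤ t then some (5 * (v / 5) + 1) else none


/-! ## The formula family used for the separation -/

namespace NE

def mat (n : ℕ) : Finset Clause :=
  (Finset.range n).image (fun i => ({Lit.pos (4*i), Lit.neg (4*i+1), Lit.pos (4*i+2)} : Clause)) ∪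
  (Finset.range n).image (fun i => ({Lit.neg (4*i), Lit.pos (4*i+1), Lit.pos (4*i+2)} : Clause)) ∪
  (Finset.range n).image (fun i => ({Lit.pos (4*i), Lit.pos (4*i+3)} : Clause)) ∪
  (Finset.range n).image (fun i => ({Lit.neg (4*i), Lit.neg (4*i+3)} : Clause)) ∪
  {(Finset.range n).image (fun i => Lit.neg (4*i+2))}

/-- `∃ x_i ∀ u_i ∃ t_i e_i`, where `x_i = 4i`, `u_i = 4i+1`, `t_i = 4i+2`, `e_i = 4i+3`. -/
def F (n : ℕ) : PCNF :=
  ⟨[(true, (List.range n).map (fun i => 4*i)), (false, (List.range n).map (fun i => 4*i+1)),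
    (true, (List.range n).map (fun i => 4*i+2) ++ (List.range n).map (fun i => 4*i+3))], mat n⟩

theorem mem_mat {n : ℕ} {C : Clause} : C ∈ mat n ↔
    (∃ i < n, C = {Lit.pos (4*i), Lit.neg (4*i+1), Lit.pos (4*i+2)}) ∨
    (∃ i < n, C = {Lit.neg (4*i), Lit.pos (4*i+1), Lit.pos (4*i+2)}) ∨
    (∃ i < n, C = {Lit.pos (4*i), Lit.pos (4*i+3)}) ∨
    (∃ i < n, C = {Lit.neg (4*i), Lit.neg (4*i+3)}) ∨
    C = (Finset.range n).image (fun i => Lit.neg (4*i+2)) := by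
  simp only [mat, Finset.mem_union, Finset.mem_image, Finset.mem_range, Finset.mem_singleton,
    or_assoc, eq_comm]

theorem mem_m0 {n v : ℕ} : v ∈ (List.range n).map (fun i => 4*i) ↔ v < 4*n ∧ v % 4 = 0 := by
  simp only [List.mem_map, List.mem_range]
  exact ⟨by rintro ⟨i, h, rfl⟩; omega, fun h => ⟨v/4, by omega, by omega⟩⟩
theorem mem_m1 {n v : ℕ} : v ∈ (List.range n).map (fun i => 4*i+1) ↔ v < 4*n ∧ v % 4 = 1 := by
  simp only [List.mem_map, List.mem_range]
  exact ⟨by rintro ⟨i, h, rfl⟩; omega, fun h => ⟨v/4, by omega, by omega⟩⟩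
theorem mem_m2 {n v : ℕ} : v ∈ (List.range n).map (fun i => 4*i+2) ↔ v < 4*n ∧ v % 4 = 2 := by
  simp only [List.mem_map, List.mem_range]
  exact ⟨by rintro ⟨i, h, rfl⟩; omega, fun h => ⟨v/4, by omega, by omega⟩⟩
theorem mem_m3 {n v : ℕ} : v ∈ (List.range n).map (fun i => 4*i+3) ↔ v < 4*n ∧ v % 4 = 3 := by
  simp only [List.mem_map, List.mem_range]
  exact ⟨by rintro ⟨i, h, rfl⟩; omega, fun h => ⟨v/4, by omega, by omega⟩⟩

theorem existB_iff {n v : ℕ} : (F n).existB v = true ↔ v < 4*n ∧ v % 4 ≠ 1 := by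
  simp only [PCNF.existB, F, List.any_cons, List.any_nil, Bool.true_and, Bool.false_and,
    Bool.false_or, Bool.or_false, Bool.or_eq_true, List.contains_iff_mem, List.mem_append,
    mem_m0, mem_m2, mem_m3]
  omega

theorem univB_iff {n v : ℕ} : (F n).univB v = true ↔ v < 4*n ∧ v % 4 = 1 := by
  simp only [PCNF.univB, F, List.any_cons, List.any_nil, Bool.not_true, Bool.not_false,
    Bool.true_and, Bool.false_and,
    Bool.false_or, Bool.or_false, List.contains_iff_mem, mem_m1]

theorem lv_eq {n v : ℕ} (h : v < 4*n) : (F n).lv v = min (v % 4) 2 := by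
  have c0 : ((List.range n).map (fun i => 4*i)).contains v = decide (v % 4 = 0) := by
    rw [Bool.eq_iff_iff]; simp only [List.contains_iff_mem, mem_m0, decide_eq_true_eq]; omega
  have c1 : ((List.range n).map (fun i => 4*i+1)).contains v = decide (v % 4 = 1) := by
    rw [Bool.eq_iff_iff]; simp only [List.contains_iff_mem, mem_m1, decide_eq_true_eq]; omega
  have c2 : ((List.range n).map (fun i => 4*i+2) ++ (List.range n).map (fun i => 4*i+3)).contains v
      = decide (2 ≤ v % 4) := by
    rw [Bool.eq_iff_iff]
    simp only [List.contains_iff_mem, List.mem_append, mem_m2, mem_m3, decide_eq_true_eq]; omega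
  simp only [PCNF.lv, F, List.findIdx_cons, List.findIdx_nil, c0, c1, c2]
  have : v % 4 < 4 := Nat.mod_lt _ (by norm_num)
  interval_cases v % 4 <;> simp

theorem wf {n : ℕ} (hn : 0 < n) : (F n).WF := by
  have inj : ∀ c, Function.Injective (fun i => 4*i+c : ℕ → ℕ) := fun c a b h => by
    simp only at h; omega
  refine ⟨by
    show List.IsChain _ _
    simp [F], ?_, ?_⟩
  · have e : (F n).allVars = (List.range n).map (fun i => 4*i) ++ ((List.range n).map (fun i => 4*i+1)
      ++ ((List.range n).map (fun i => 4*i+2) ++ (List.range n).map (fun i => 4*i+3))) := by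
      simp [F, PCNF.allVars]
    rw [e]
    have nd : ∀ c, ((List.range n).map (fun i => 4*i+c)).Nodup := fun c =>
      List.nodup_range.map (inj c)
    refine List.nodup_append'.2 ⟨nd 0, List.nodup_append'.2 ⟨nd 1, List.nodup_append'.2 ⟨nd 2, nd 3, ?_⟩, ?_⟩, ?_⟩
    all_goals
      intro v h1 h2
      simp only [List.mem_append, mem_m0, mem_m1, mem_m2, mem_m3] at h1 h2
      omega
  · intro b hb
    simp only [F, List.mem_cons, List.not_mem_nil, or_false] at hb
    rcases hb with rfl | rfl | rfl <;> simp <;> omega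

theorem mem_allVars {n v : ℕ} : v ∈ (F n).allVars ↔ v < 4*n := by
  have e : (F n).allVars = (List.range n).map (fun i => 4*i) ++ ((List.range n).map (fun i => 4*i+1)
      ++ ((List.range n).map (fun i => 4*i+2) ++ (List.range n).map (fun i => 4*i+3))) := by
      simp [F, PCNF.allVars]
  rw [e]
  simp only [List.mem_append, mem_m0, mem_m1, mem_m2, mem_m3]
  omega

theorem mat_var {n : ℕ} {C : Clause} (hC : C ∈ mat n) {l : Lit} (hl : l ∈ C) : l.var < 4*n := by
  rcases mem_mat.1 hC with ⟨i, hi, rfl⟩ | ⟨i, hi, rfl⟩ | ⟨i, hi, rfl⟩ | ⟨i, hi, rfl⟩ | rfl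
  all_goals simp only [Finset.mem_insert, Finset.mem_singleton, Finset.mem_image,
    Finset.mem_range] at hl
  · rcases hl with rfl | rfl | rfl <;> simp only [Lit.var] <;> omega
  · rcases hl with rfl | rfl | rfl <;> simp only [Lit.var] <;> omega
  · rcases hl with rfl | rfl <;> simp only [Lit.var] <;> omega
  · rcases hl with rfl | rfl <;> simp only [Lit.var] <;> omega
  · rcases hl with ⟨i, hi, rfl⟩; simp only [Lit.var]; omega

theorem closed (n : ℕ) : (F n).Closed := fun _ hC _ hl => mem_allVars.2 (mat_var hC hl)

/-- Every matrix clause contains a literal over the last block. -/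
theorem mat_T {n : ℕ} (hn : 0 < n) {C : Clause} (hC : C ∈ mat n) : ∃ l ∈ C, 2 ≤ l.var % 4 := by
  rcases mem_mat.1 hC with ⟨i, hi, rfl⟩ | ⟨i, hi, rfl⟩ | ⟨i, hi, rfl⟩ | ⟨i, hi, rfl⟩ | rfl
  · exact ⟨Lit.pos (4*i+2), by simp, by simp only [Lit.var]; omega⟩
  · exact ⟨Lit.pos (4*i+2), by simp, by simp only [Lit.var]; omega⟩
  · exact ⟨Lit.pos (4*i+3), by simp, by simp only [Lit.var]; omega⟩
  · exact ⟨Lit.neg (4*i+3), by simp, by simp only [Lit.var]; omega⟩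
  · exact ⟨Lit.neg (4*0+2), Finset.mem_image.2 ⟨0, by simpa using hn, rfl⟩, by simp only [Lit.var]; omega⟩

def Sat (n : ℕ) (v : ℕ → Bool) : Prop := ∀ C ∈ mat n, evalClause v C

theorem sat_necessary {n : ℕ} {v : ℕ → Bool} (h : Sat n v) : ∃ i < n, v (4*i+1) = v (4*i) := by
  obtain ⟨l, hl, hv⟩ := h _ (mem_mat.2 (Or.inr (Or.inr (Or.inr (Or.inr rfl)))))
  obtain ⟨i, hi, rfl⟩ := Finset.mem_image.1 hl
  have hi := Finset.mem_range.1 hi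
  refine ⟨i, hi, ?_⟩
  have h1 := h _ (mem_mat.2 (Or.inl ⟨i, hi, rfl⟩))
  have h2 := h _ (mem_mat.2 (Or.inr (Or.inl ⟨i, hi, rfl⟩)))
  simp only [evalClause, Finset.mem_insert, Finset.mem_singleton, exists_eq_or_imp,
    exists_eq_left, Lit.eval] at h1 h2 hv
  revert h1 h2 hv
  cases v (4*i+1) <;> cases v (4*i) <;> cases v (4*i+2) <;> simp

theorem sat_extend {n : ℕ} {v : ℕ → Bool} (h : ∃ i < n, v (4*i+1) = v (4*i)) :
    ∃ w, Sat n w ∧ ∀ x, x % 4 < 2 → w x = v x := by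
  let w : ℕ → Bool := fun x => if x % 4 = 2 then xor (v (x-1)) (v (x-2))
    else if x % 4 = 3 then !(v (x-3)) else v x
  have w0 : ∀ i, w (4*i) = v (4*i) := fun i => by
    have h1 : ¬ (4*i) % 4 = 2 := by omega
    have h2 : ¬ (4*i) % 4 = 3 := by omega
    simp only [w, h1, h2, if_false]
  have w1 : ∀ i, w (4*i+1) = v (4*i+1) := fun i => by
    have h1 : ¬ (4*i+1) % 4 = 2 := by omega
    have h2 : ¬ (4*i+1) % 4 = 3 := by omega
    simp only [w, h1, h2, if_false]
  have w2 : ∀ i, w (4*i+2) = xor (v (4*i+1)) (v (4*i)) := fun i => by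
    have h1 : (4*i+2) % 4 = 2 := by omega
    simp only [w, h1, if_true]; rfl
  have w3 : ∀ i, w (4*i+3) = !(v (4*i)) := fun i => by
    have h1 : (4*i+3) % 4 = 3 := by omega
    simp only [w, h1, if_true]; rfl
  refine ⟨w, ?_, ?_⟩
  · intro C hC
    rcases mem_mat.1 hC with ⟨i, hi, rfl⟩ | ⟨i, hi, rfl⟩ | ⟨i, hi, rfl⟩ | ⟨i, hi, rfl⟩ | rfl
    all_goals try
      simp only [evalClause, Finset.mem_insert, Finset.mem_singleton, exists_eq_or_imp,
        exists_eq_left, Lit.eval, w0, w1, w2, w3]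
      cases v (4*i+1) <;> cases v (4*i) <;> simp
    obtain ⟨i, hi, e⟩ := h
    exact ⟨Lit.neg (4*i+2), Finset.mem_image.2 ⟨i, by simpa using hi, rfl⟩, by
      simp [Lit.eval, w2, e]⟩
  · intro x hx
    have h1 : ¬ x % 4 = 2 := by omega
    have h2 : ¬ x % 4 = 3 := by omega
    simp only [w, h1, h2, if_false]

theorem not_true {n : ℕ} : ¬ (F n).IsTrue := by
  simp only [PCNF.IsTrue, F, truthAux, if_true]
  rintro ⟨w1, -, h⟩
  obtain ⟨w3, h3, hs⟩ := h (fun y => if y % 4 = 1 ∧ y < 4*n then !(w1 (y-1)) else w1 y) (by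
    intro y hy
    rw [mem_m1] at hy
    rw [if_neg (by omega)])
  obtain ⟨i, hi, e⟩ := sat_necessary (n := n) hs
  have a := h3 (4*i+1) (by simp only [List.mem_append, mem_m2, mem_m3]; omega)
  have b := h3 (4*i) (by simp only [List.mem_append, mem_m2, mem_m3]; omega)
  rw [if_pos (by omega)] at a
  rw [if_neg (by omega)] at b
  rw [a, b] at e
  simp at e

end NE

namespace NE

/-! ### Lower bound for QU-resolution -/

theorem getElem!_eq {α} [Inhabited α] (π : List α) (i : ℕ) (h : i < π.length) : π[i]! = π[i] := by
  simp [h]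

theorem list_ind {α} [Inhabited α] {π : List α} {Step : List α → α → Prop} {P : α → Prop}
    (hv : ∀ i < π.length, Step (π.take i) π[i]!)
    (hs : ∀ prev C, (∀ D ∈ prev, P D ∧ D ∈ π) → C ∈ π → Step prev C → P C) : ∀ C ∈ π, P C := by
  have key : ∀ i (h : i < π.length), P π[i] := by
    intro i
    induction i using Nat.strong_induction_on with
    | _ i ih =>
      intro h
      have h1 := hv i h
      rw [getElem!_eq π i h] at h1
      refine hs _ _ ?_ (List.getElem_mem h) h1
      intro D hD
      obtain ⟨j, hj, rfl⟩ := List.getElem_of_mem hD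
      have hj' : j < i ∧ j < π.length := by simpa using hj
      rw [List.getElem_take]
      exact ⟨ih j hj'.1 hj'.2, List.getElem_mem _⟩
  intro C hC
  obtain ⟨j, hj, rfl⟩ := List.getElem_of_mem hC
  exact key j hj

theorem getLast!_mem {α} [Inhabited α] {π : List α} (h : π ≠ []) : π.getLast! ∈ π := by
  rw [List.getLast!_of_getLast? (List.getLast?_eq_getLast_of_ne_nil h)]
  exact List.getLast_mem h

theorem eval_negate (v : ℕ → Bool) (l : Lit) : l.negate.eval v = !(l.eval v) := by
  cases l <;> simp [Lit.negate, Lit.eval]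

def Found (n : ℕ) (α : ℕ → Bool) (C : Clause) : Prop :=
  ¬ C.Taut ∧ (∀ l ∈ C, l.var % 4 < 2) ∧ (∀ l ∈ C, l.var % 4 = 0 → l.eval α = false) ∧
    ∀ v, Sat n v → (∀ x, x % 4 = 0 → v x = α x) → evalClause v C

theorem eval_congr {v w : ℕ → Bool} {l : Lit} (h : v l.var = w l.var) : l.eval v = l.eval w := by
  cases l <;> simp_all [Lit.eval, Lit.var]

theorem q_step {n : ℕ} {b : Bool} {α : ℕ → Bool} {π prev : List Clause} {C : Clause}
    (hp : ∀ D ∈ prev, ((¬ D.Taut ∧ ∀ l ∈ D, l.var < 4*n) ∧ ((∃ E ∈ π, Found n α E) ∨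
      ∀ v, Sat n v → (∀ x, x % 4 = 0 → v x = α x) → evalClause v D)) ∧ D ∈ π)
    (h : QStep (F n) b prev C) : (¬ C.Taut ∧ ∀ l ∈ C, l.var < 4*n) ∧ ((∃ E ∈ π, Found n α E) ∨
      ∀ v, Sat n v → (∀ x, x % 4 = 0 → v x = α x) → evalClause v C) := by
  cases h with
  | ax _ hC hnt => exact ⟨⟨hnt, fun l hl => mat_var hC hl⟩, Or.inr fun v hv _ => hv _ hC⟩
  | res x A B hA hB hxa hxb hpiv hblock =>
    obtain ⟨⟨⟨tA, vA⟩, fA⟩, -⟩ := hp A hA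
    obtain ⟨⟨⟨tB, vB⟩, fB⟩, -⟩ := hp B hB
    refine ⟨⟨?_, ?_⟩, ?_⟩
    · rintro ⟨y, h1, h2⟩
      rcases Finset.mem_union.1 h1 with h1 | h1 <;> rcases Finset.mem_union.1 h2 with h2 | h2
      · exact tA ⟨y, Finset.mem_of_mem_erase h1, Finset.mem_of_mem_erase h2⟩
      · exact hblock _ h1 h2
      · exact hblock _ h2 h1
      · exact tB ⟨y, Finset.mem_of_mem_erase h1, Finset.mem_of_mem_erase h2⟩
    · intro l hl
      rcases Finset.mem_union.1 hl with hl | hl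
      · exact vA l (Finset.mem_of_mem_erase hl)
      · exact vB l (Finset.mem_of_mem_erase hl)
    · rcases fA with fA | fA
      · exact Or.inl fA
      rcases fB with fB | fB
      · exact Or.inl fB
      refine Or.inr fun v hv hα => ?_
      obtain ⟨l, hl, el⟩ := fA v hv hα
      obtain ⟨m, hm, em⟩ := fB v hv hα
      by_cases e1 : l = Lit.pos x
      · by_cases e2 : m = Lit.neg x
        · subst e1 e2; simp [Lit.eval] at el em; simp_all
        · exact ⟨m, Finset.mem_union_right _ (Finset.mem_erase.2 ⟨e2, hm⟩), em⟩
      · exact ⟨l, Finset.mem_union_left _ (Finset.mem_erase.2 ⟨e1, hl⟩), el⟩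
  | fac _ hA => exact (hp _ hA).1
  | univRed A m hA hm hu hlv =>
    obtain ⟨⟨⟨tA, vA⟩, fA⟩, mA⟩ := hp A hA
    refine ⟨⟨?_, fun l hl => vA l (Finset.mem_of_mem_erase hl)⟩, ?_⟩
    · rintro ⟨y, h1, h2⟩
      exact tA ⟨y, Finset.mem_of_mem_erase h1, Finset.mem_of_mem_erase h2⟩
    rcases fA with fA | fA
    · exact Or.inl fA
    rw [univB_iff] at hu
    by_cases hX : ∃ l ∈ A, l.var % 4 = 0 ∧ l.eval α = true
    · obtain ⟨l, hl, h0, ev⟩ := hX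
      refine Or.inr fun v hv hα => ⟨l, Finset.mem_erase.2 ⟨?_, hl⟩, ?_⟩
      · rintro rfl; omega
      · rw [eval_congr (hα _ h0), ev]
    · refine Or.inl ⟨A, mA, tA, ?_, ?_, fA⟩
      · intro l hl
        by_cases e : l = m
        · subst e; omega
        · by_contra hc
          have := hlv l (Finset.mem_erase.2 ⟨e, hl⟩) (existB_iff.2 ⟨vA l hl, by omega⟩)
          rw [lv_eq (vA l hl), lv_eq (vA m hm)] at this
          omega
      · intro l hl h0
        by_contra hc
        exact hX ⟨l, hl, h0, by simpa using hc⟩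

theorem found_det {n : ℕ} {α : ℕ → Bool} {C : Clause} (h : Found n α C) :
    ∀ i < n, α (4*i) = !decide (Lit.neg (4*i+1) ∈ C) := by
  obtain ⟨nt, hT, hX, hs⟩ := h
  intro i hi
  by_contra hc
  have hc : α (4*i) = decide (Lit.neg (4*i+1) ∈ C) := by
    revert hc; cases α (4*i) <;> cases decide (Lit.neg (4*i+1) ∈ C) <;> simp
  obtain ⟨w, hw, e⟩ := sat_extend (n := n)
    (v := fun x => if x % 4 = 1 then decide (Lit.neg x ∈ C) else α x) ⟨i, hi, by
      rw [if_pos (by omega), if_neg (by omega), hc]⟩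
  obtain ⟨l, hl, ev⟩ := hs w hw fun x hx => by rw [e x (by omega), if_neg (by omega)]
  have hlt := hT l hl
  by_cases h0 : l.var % 4 = 0
  · have := hX l hl h0
    rw [eval_congr (w := α)] at ev
    · simp [this] at ev
    · rw [e _ hlt, if_neg (by omega)]
  · have e' := e _ hlt
    rw [if_pos (by omega)] at e'
    cases l with
    | pos y =>
      simp only [Lit.eval, Lit.var] at ev e'
      rw [ev] at e'
      exact nt ⟨y, hl, of_decide_eq_true e'.symm⟩
    | neg y =>
      simp only [Lit.eval, Lit.var] at ev e'
      rw [e'] at ev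
      rw [Bool.not_eq_true'] at ev
      exact of_decide_eq_false ev hl

theorem found_nonempty {n : ℕ} (hn : 0 < n) {α : ℕ → Bool} {C : Clause} (h : Found n α C) :
    C.Nonempty := by
  obtain ⟨w, hw, e⟩ := sat_extend (n := n) (v := fun x => α (x - x % 4)) ⟨0, hn, by simp⟩
  obtain ⟨l, hl, -⟩ := h.2.2.2 w hw fun x hx => by rw [e x (by omega), hx]; rfl
  exact ⟨l, hl⟩

theorem q_found {n : ℕ} (hn : 0 < n) {b : Bool} {π : List Clause} (h : QRefutation (F n) b π)
    (α : ℕ → Bool) : ∃ E ∈ π, Found n α E := by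
  have h1 := list_ind h.1 (P := fun D => (¬ D.Taut ∧ ∀ l ∈ D, l.var < 4*n) ∧
      ((∃ E ∈ π, Found n α E) ∨
      ∀ v, Sat n v → (∀ x, x % 4 = 0 → v x = α x) → evalClause v D))
    (fun prev C hp _ hs => q_step hp hs) _ (getLast!_mem h.2.1)
  rw [h.2.2] at h1
  rcases h1.2 with h1 | h1
  · exact h1
  · obtain ⟨w, hw, e⟩ := sat_extend (n := n) (v := fun x => α (x - x % 4)) ⟨0, hn, by simp⟩
    obtain ⟨l, hl, -⟩ := h1 w hw fun x hx => by rw [e x (by omega), hx]; rfl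
    simp at hl

/-- Assignment to the `x_i` given by a bit vector. -/
def asg {n : ℕ} (a : Fin n → Bool) : ℕ → Bool :=
  fun x => if h : x / 4 < n then a ⟨x / 4, h⟩ else false

theorem asg_x {n : ℕ} (a : Fin n → Bool) (i : Fin n) : asg a (4 * i.1) = a i := by
  have : 4 * i.1 / 4 = i.1 := by omega
  simp [asg]

theorem sum_ge {α : Type*} [DecidableEq α] (f : α → ℕ) (π : List α) (S : Finset α)
    (hS : ∀ a ∈ S, a ∈ π) : ∑ a ∈ S, f a ≤ (π.map f).sum := by
  induction π generalizing S with
  | nil =>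
    have : S = ∅ := Finset.eq_empty_of_forall_notMem fun a ha => by simpa using hS a ha
    simp [this]
  | cons b π ih =>
    have h1 := ih (S.erase b) fun a ha => by
      have := hS a (Finset.mem_of_mem_erase ha)
      simp only [List.mem_cons] at this
      exact this.resolve_left (Finset.ne_of_mem_erase ha)
    have h2 : ∑ a ∈ S, f a ≤ f b + ∑ a ∈ S.erase b, f a := by
      by_cases hb : b ∈ S
      · rw [Finset.add_sum_erase _ _ hb]
      · rw [Finset.erase_eq_of_notMem hb]; omega
    simp only [List.map_cons, List.sum_cons]
    omega

theorem q_lower {n : ℕ} (hn : 0 < n) {b : Bool} {π : List Clause} (h : QRefutation (F n) b π) :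
    2 ^ n ≤ qSize π := by
  classical
  choose f hf hF using fun a : Fin n → Bool => q_found hn h (asg a)
  have inj : Function.Injective f := by
    intro a a' e
    funext i
    rw [← asg_x a i, ← asg_x a' i, found_det (hF a) i i.2, found_det (hF a') i i.2, e]
  have h1 := sum_ge Finset.card π (Finset.univ.image f) (by
    intro C hC; obtain ⟨a, -, rfl⟩ := Finset.mem_image.1 hC; exact hf a)
  have h2 : (Finset.univ.image f).card = 2 ^ n := by
    rw [Finset.card_image_of_injective _ inj]; simp
  have h3 : (Finset.univ.image f).card ≤ ∑ a ∈ Finset.univ.image f, a.card := by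
    rw [Finset.card_eq_sum_ones]
    refine Finset.sum_le_sum fun C hC => ?_
    obtain ⟨a, -, rfl⟩ := Finset.mem_image.1 hC
    exact (found_nonempty hn (hF a)).card_pos
  exact h2.symm.le.trans (h3.trans h1)

/-! ### Lower bound for IR-calc with a substitution -/

def Compat (β : ℕ → Bool) (τ : Ann) : Prop := ∀ p ∈ τ, β p.1 = p.2

def Good (n : ℕ) (σv : ℕ → Option ℕ) (α β v : ℕ → Bool) : Prop :=
  Sat n v ∧ (∀ x, x % 4 = 0 → v x = α x) ∧ (∀ x, x % 4 = 1 → σv x = none → v x = β x) ∧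
    ∀ x e, σv x = some e → v x = v e

def XTrue (α : ℕ → Bool) (D : AClause) : Prop :=
  ∃ al ∈ D, al.lit.var % 4 = 0 ∧ al.lit.eval α = true

def J (n : ℕ) (σv : ℕ → Option ℕ) (α : ℕ → Bool) (π : List AClause) (D : AClause) : Prop :=
  XTrue α D ∨ ∃ (τ : Ann) (W : Set Lit), (∃ E ∈ π, ∃ al ∈ E, al.ann = τ) ∧
    τ.Functional ∧ (∀ p ∈ τ, (F n).univB p.1 = true) ∧
    (∀ l ∈ W, 2 ≤ l.var % 4 ∧ l.var < 4*n ∧ (⟨l, τ⟩ : ALit) ∈ D) ∧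
    ∀ β v, Compat β τ → Good n σv α β v → ∃ l ∈ W, l.eval v = true

theorem eval_sigv {σv : ℕ → Option ℕ} {v : ℕ → Bool} (h : ∀ x e, σv x = some e → v x = v e)
    (l : Lit) : (applySigv σv l).eval v = l.eval v := by
  cases l with
  | pos x => simp only [applySigv]; cases e : σv x <;> simp [Lit.eval]; exact (h _ _ e).symm
  | neg x => simp only [applySigv]; cases e : σv x <;> simp [Lit.eval]; rw [(h _ _ e)]

theorem sigv_var {n : ℕ} {σv : ℕ → Option ℕ} (ha : Admissible (F n) σv) (l : Lit) (hl : l.var < 4*n) :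
    (applySigv σv l).var < 4*n ∧ (2 ≤ l.var % 4 → applySigv σv l = l) ∧
      ((applySigv σv l).var % 4 = 1 → σv (applySigv σv l).var = none) := by
  have key : ∀ x e, σv x = some e → x % 4 = 1 ∧ e % 4 = 0 ∧ e < 4*n := by
    intro x e h
    obtain ⟨h1, h2, h3⟩ := ha x e h
    rw [univB_iff] at h1
    rw [existB_iff] at h2
    rw [lv_eq h1.1, lv_eq h2.1] at h3
    omega
  cases l with
  | pos x =>
    simp only [Lit.var] at hl ⊢
    simp only [applySigv]
    cases e : σv x with
    | none => exact ⟨hl, fun _ => rfl, fun _ => e⟩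
    | some y => have := key x y e; exact ⟨this.2.2, fun _ => by omega, fun h => by simp only at h; omega⟩
  | neg x =>
    simp only [Lit.var] at hl ⊢
    simp only [applySigv]
    cases e : σv x with
    | none => exact ⟨hl, fun _ => rfl, fun _ => e⟩
    | some y => have := key x y e; exact ⟨this.2.2, fun _ => by omega, fun h => by simp only at h; omega⟩

theorem mem_axAnn {n : ℕ} {C : Clause} {p : ℕ × Bool} : p ∈ axAnn (F n) C ↔
    (F n).univB p.1 = true ∧ ((p.2 = false ∧ Lit.pos p.1 ∈ C) ∨ (p.2 = true ∧ Lit.neg p.1 ∈ C)) := by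
  obtain ⟨x, b⟩ := p
  simp only [axAnn, Finset.mem_image, Finset.mem_filter]
  constructor
  · rintro ⟨l, ⟨hl, hu⟩, e⟩
    cases l <;> simp only [Prod.mk.injEq, Lit.var] at e hu <;> obtain ⟨rfl, rfl⟩ := e <;> simp_all
  · rintro ⟨hu, ⟨rfl, h⟩ | ⟨rfl, h⟩⟩
    · exact ⟨_, ⟨h, hu⟩, rfl⟩
    · exact ⟨_, ⟨h, hu⟩, rfl⟩

theorem annRestr_eq {n : ℕ} {τ : Ann} {l : Lit} (hτ : ∀ p ∈ τ, (F n).univB p.1 = true)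
    (hl : 2 ≤ l.var % 4) (hl' : l.var < 4*n) : annRestr (F n) τ l = τ := by
  refine Finset.filter_true_of_mem fun p hp => ?_
  have := univB_iff.1 (hτ p hp)
  rw [lv_eq this.1, lv_eq hl']
  omega

theorem ir_step {n : ℕ} (hn : 0 < n) {σv : ℕ → Option ℕ} (ha : Admissible (F n) σv)
    {α : ℕ → Bool} {π prev : List AClause}
    {C : AClause} (hp : ∀ D ∈ prev, J n σv α π D ∧ D ∈ π) (hC : C ∈ π)
    (h : IRStep (F n) ∅ σv prev C) : J n σv α π C := by
  by_cases hX : XTrue α C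
  · exact Or.inl hX
  cases h with
  | ax C hCm hnt hnt' =>
    right
    have hu : ∀ p ∈ axAnn (F n) (C.applySigv σv), (F n).univB p.1 = true :=
      fun p hp => (mem_axAnn.1 hp).1
    have hmem : ∀ l ∈ C.applySigv σv, l.var < 4*n := by
      intro l hl
      obtain ⟨m, hm, rfl⟩ := Finset.mem_image.1 hl
      exact (sigv_var ha m (mat_var hCm hm)).1
    have hin : ∀ l ∈ C.applySigv σv, 2 ≤ l.var % 4 →
        (⟨l, axAnn (F n) (C.applySigv σv)⟩ : ALit) ∈ axClause (F n) (C.applySigv σv) := by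
      intro l hl h2
      refine Finset.mem_image.2 ⟨l, Finset.mem_filter.2 ⟨hl, existB_iff.2 ⟨hmem l hl, by omega⟩⟩, ?_⟩
      rw [annRestr_eq hu h2 (hmem l hl)]
    refine ⟨axAnn (F n) (C.applySigv σv), {l | l ∈ C.applySigv σv ∧ 2 ≤ l.var % 4}, ?_, ?_, hu, ?_, ?_⟩
    · obtain ⟨l, hl, h2⟩ := mat_T hn hCm
      have e := (sigv_var ha l (mat_var hCm hl)).2.1 h2
      exact ⟨_, hC, _, hin l (Finset.mem_image.2 ⟨l, hl, e⟩) h2, rfl⟩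
    · intro x b b' h1 h2
      rcases (mem_axAnn.1 h1).2 with ⟨e1, h1⟩ | ⟨e1, h1⟩ <;>
      rcases (mem_axAnn.1 h2).2 with ⟨e2, h2⟩ | ⟨e2, h2⟩
      · simp_all
      · exact absurd ⟨x, h1, h2⟩ hnt'
      · exact absurd ⟨x, h2, h1⟩ hnt'
      · simp_all
    · intro l hl
      exact ⟨hl.2, hmem l hl.1, hin l hl.1 hl.2⟩
    · intro β v hβ hv
      obtain ⟨m, hm, em⟩ := hv.1 _ hCm
      have hl : applySigv σv m ∈ C.applySigv σv := Finset.mem_image.2 ⟨m, hm, rfl⟩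
      have sv := (sigv_var ha m (mat_var hCm hm)).2.2
      rw [← eval_sigv hv.2.2.2] at em
      generalize applySigv σv m = l at hl em sv
      refine ⟨l, ⟨hl, ?_⟩, em⟩
      by_contra hc
      have hcases : l.var % 4 = 0 ∨ l.var % 4 = 1 := by omega
      rcases hcases with h0 | h1
      · refine hX ⟨⟨l, _⟩, Finset.mem_image.2 ⟨l, Finset.mem_filter.2 ⟨hl, existB_iff.2 ⟨hmem l hl, by omega⟩⟩, rfl⟩, h0, ?_⟩
        rw [← em]
        exact eval_congr (hv.2.1 _ h0).symm
      · have hb := hv.2.2.1 _ h1 (sv h1)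
        have hul := univB_iff.2 ⟨hmem l hl, h1⟩
        cases l with
        | pos x =>
          have := hβ (x, false) (mem_axAnn.2 ⟨hul, Or.inl ⟨rfl, hl⟩⟩)
          simp_all [Lit.eval, Lit.var]
        | neg x =>
          have := hβ (x, true) (mem_axAnn.2 ⟨hul, Or.inr ⟨rfl, hl⟩⟩)
          simp_all [Lit.eval, Lit.var]
  | axExt C' hC' hnt => exact absurd hC' (Finset.notMem_empty _)
  | res x τ A B hA hB hxa hxb =>
    right
    have jA := (hp A hA).1
    have jB := (hp B hB).1
    have xA : XTrue α A → x % 4 = 0 ∧ α x = true := by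
      rintro ⟨al, hal, h0, e⟩
      by_cases h : al = ⟨Lit.pos x, τ⟩
      · subst h; exact ⟨h0, e⟩
      · exact absurd ⟨al, Finset.mem_union_left _ (Finset.mem_erase.2 ⟨h, hal⟩), h0, e⟩ hX
    have xB : XTrue α B → x % 4 = 0 ∧ α x = false := by
      rintro ⟨al, hal, h0, e⟩
      by_cases h : al = ⟨Lit.neg x, τ⟩
      · subst h; exact ⟨h0, by simpa [Lit.eval] using e⟩
      · exact absurd ⟨al, Finset.mem_union_right _ (Finset.mem_erase.2 ⟨h, hal⟩), h0, e⟩ hX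
    -- keeping the witness of `A` when the pivot is not among its literals
    have useA : ∀ (τ' : Ann) (W : Set Lit), (¬ (τ' = τ ∧ Lit.pos x ∈ W)) →
        (∀ l ∈ W, 2 ≤ l.var % 4 ∧ l.var < 4*n ∧ (⟨l, τ'⟩ : ALit) ∈ A) →
        (∀ l ∈ W, 2 ≤ l.var % 4 ∧ l.var < 4*n ∧ (⟨l, τ'⟩ : ALit) ∈
          A.erase ⟨Lit.pos x, τ⟩ ∪ B.erase ⟨Lit.neg x, τ⟩) := by
      intro τ' W hne hW l hl
      refine ⟨(hW l hl).1, (hW l hl).2.1, Finset.mem_union_left _ (Finset.mem_erase.2 ⟨?_, (hW l hl).2.2⟩)⟩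
      intro e
      injection e with e1 e2
      exact hne ⟨e2, e1 ▸ hl⟩
    have useB : ∀ (τ' : Ann) (W : Set Lit), (¬ (τ' = τ ∧ Lit.neg x ∈ W)) →
        (∀ l ∈ W, 2 ≤ l.var % 4 ∧ l.var < 4*n ∧ (⟨l, τ'⟩ : ALit) ∈ B) →
        (∀ l ∈ W, 2 ≤ l.var % 4 ∧ l.var < 4*n ∧ (⟨l, τ'⟩ : ALit) ∈
          A.erase ⟨Lit.pos x, τ⟩ ∪ B.erase ⟨Lit.neg x, τ⟩) := by
      intro τ' W hne hW l hl
      refine ⟨(hW l hl).1, (hW l hl).2.1, Finset.mem_union_right _ (Finset.mem_erase.2 ⟨?_, (hW l hl).2.2⟩)⟩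
      intro e
      injection e with e1 e2
      exact hne ⟨e2, e1 ▸ hl⟩
    rcases jA with jA | ⟨τA, WA, oA, fA, uA, mA, sA⟩
    · rcases jB with jB | ⟨τB, WB, oB, fB, uB, mB, sB⟩
      · have := (xA jA).2; have := (xB jB).2; simp_all
      · refine ⟨τB, WB, oB, fB, uB, useB τB WB ?_ mB, sB⟩
        rintro ⟨-, h⟩
        have h1 : 2 ≤ x % 4 := (mB _ h).1
        have := (xA jA).1
        omega
    · by_cases cA : τA = τ ∧ Lit.pos x ∈ WA
      · rcases jB with jB | ⟨τB, WB, oB, fB, uB, mB, sB⟩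
        · have h1 : 2 ≤ x % 4 := (mA _ cA.2).1
          have := (xB jB).1
          omega
        · by_cases cB : τB = τ ∧ Lit.neg x ∈ WB
          · obtain ⟨rfl, hxA⟩ := cA
            obtain ⟨rfl, hxB⟩ := cB
            refine ⟨τB, {l | (l ∈ WA ∧ l ≠ Lit.pos x) ∨ (l ∈ WB ∧ l ≠ Lit.neg x)}, oA, fA, uA, ?_, ?_⟩
            · rintro l (⟨hl, hne⟩ | ⟨hl, hne⟩)
              · exact ⟨(mA l hl).1, (mA l hl).2.1, Finset.mem_union_left _
                  (Finset.mem_erase.2 ⟨fun e => hne (by injection e), (mA l hl).2.2⟩)⟩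
              · exact ⟨(mB l hl).1, (mB l hl).2.1, Finset.mem_union_right _
                  (Finset.mem_erase.2 ⟨fun e => hne (by injection e), (mB l hl).2.2⟩)⟩
            · intro β v hβ hv
              obtain ⟨l, hl, el⟩ := sA β v hβ hv
              obtain ⟨m, hm, em⟩ := sB β v hβ hv
              by_cases e1 : l = Lit.pos x
              · by_cases e2 : m = Lit.neg x
                · subst e1 e2; simp [Lit.eval] at el em; simp_all
                · exact ⟨m, Or.inr ⟨hm, e2⟩, em⟩
              · exact ⟨l, Or.inl ⟨hl, e1⟩, el⟩
          · exact ⟨τB, WB, oB, fB, uB, useB τB WB cB mB, sB⟩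
      · exact ⟨τA, WA, oA, fA, uA, useA τA WA cA mA, sA⟩
  | fac _ hA => exact (hp _ hA).1
  | inst A ρ hA hfun hdom =>
    rcases (hp A hA).1 with ⟨al, hal, h0, e⟩ | ⟨τ, W, o, f, u, m, s⟩
    · exact absurd ⟨_, Finset.mem_image.2 ⟨al, hal, rfl⟩, h0, e⟩ hX
    right
    by_cases hW : W.Nonempty
    · have u' : ∀ p ∈ annCompl τ ρ, (F n).univB p.1 = true := by
        intro p hp
        rcases Finset.mem_union.1 hp with hp | hp
        · exact u p hp
        · exact hdom p (Finset.mem_filter.1 hp).1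
      have m' : ∀ l ∈ W, 2 ≤ l.var % 4 ∧ l.var < 4*n ∧ (⟨l, annCompl τ ρ⟩ : ALit) ∈
          A.image fun al => (⟨al.lit, annRestr (F n) (annCompl al.ann ρ) al.lit⟩ : ALit) := by
        intro l hl
        refine ⟨(m l hl).1, (m l hl).2.1, Finset.mem_image.2 ⟨_, (m l hl).2.2, ?_⟩⟩
        simp only
        rw [annRestr_eq u' (m l hl).1 (m l hl).2.1]
      refine ⟨annCompl τ ρ, W, ?_, ?_, u', m', ?_⟩
      · obtain ⟨l, hl⟩ := hW
        exact ⟨_, hC, _, (m' l hl).2.2, rfl⟩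
      · intro x b b' h1 h2
        simp only [annCompl, Finset.mem_union, Finset.mem_filter, Finset.mem_image] at h1 h2
        rcases h1 with h1 | ⟨h1, h1'⟩ <;> rcases h2 with h2 | ⟨h2, h2'⟩
        · exact f x b b' h1 h2
        · exact absurd ⟨_, h1, rfl⟩ h2'
        · exact absurd ⟨_, h2, rfl⟩ h1'
        · exact hfun x b b' h1 h2
      · intro β v hβ hv
        exact s β v (fun p hp => hβ p (Finset.mem_union_left _ hp)) hv
    · refine ⟨τ, W, o, f, u, fun l hl => absurd ⟨l, hl⟩ hW, s⟩

theorem ir_found {n : ℕ} (hn : 0 < n) {σv : ℕ → Option ℕ} (ha : Admissible (F n) σv)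
    {π : List AClause} (h : IRRefutation (F n) ∅ σv π) (α : ℕ → Bool) :
    ∃ τ : Ann, (∃ E ∈ π, ∃ al ∈ E, al.ann = τ) ∧ τ.Functional ∧
      ∀ β v, Compat β τ → ¬ Good n σv α β v := by
  have h1 := list_ind h.1 (P := J n σv α π)
    (fun prev C hp hC hs => ir_step hn ha hp hC hs) _ (getLast!_mem h.2.1)
  rw [h.2.2] at h1
  rcases h1 with ⟨al, hal, -⟩ | ⟨τ, W, o, f, -, m, s⟩
  · simp at hal
  · refine ⟨τ, o, f, fun β v hβ hv => ?_⟩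
    obtain ⟨l, hl, -⟩ := s β v hβ hv
    simpa using (m l hl).2.2

theorem ir_det {n : ℕ} {σv : ℕ → Option ℕ} (ha : Admissible (F n) σv) {α : ℕ → Bool} {τ : Ann}
    (hf : τ.Functional) (h : ∀ β v, Compat β τ → ¬ Good n σv α β v) :
    ∀ i < n, (σv (4*i+1) = none → α (4*i) = !decide ((4*i+1, true) ∈ τ)) ∧
      ∀ e, σv (4*i+1) = some e → α (4*i) ≠ α e := by
  have main : ∀ i < n, α (4*i) ≠ (match σv (4*i+1) with
      | none => decide ((4*i+1, true) ∈ τ) | some e => α e) := by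
    intro i hi hc
    obtain ⟨w, hw, e⟩ := sat_extend (n := n)
      (v := fun x => if x % 4 = 1 then (match σv x with
        | none => decide ((x, true) ∈ τ) | some e => α e) else α x) ⟨i, hi, by
        rw [if_pos (by omega), if_neg (by omega), hc]⟩
    refine h (fun x => decide ((x, true) ∈ τ)) w ?_ ⟨hw, ?_, ?_, ?_⟩
    · rintro ⟨x, b⟩ hp
      cases b
      · simp only [decide_eq_false_iff_not]
        intro h'; have := hf _ _ _ hp h'; simp at this
      · simpa using hp
    · intro x hx; rw [e x (by omega), if_neg (by omega)]
    · intro x hx hs; rw [e x (by omega), if_pos hx, hs]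
    · intro x y hs
      obtain ⟨h1, h2, h3⟩ := ha x y hs
      rw [univB_iff] at h1
      rw [existB_iff] at h2
      rw [lv_eq h1.1, lv_eq h2.1] at h3
      rw [e x (by omega), if_pos (by omega), hs, e y (by omega), if_neg (by omega)]
  intro i hi
  have := main i hi
  constructor
  · intro hs
    rw [hs] at this
    simp only at this
    revert this
    cases α (4*i) <;> cases decide ((4*i+1, true) ∈ τ) <;> simp
  · intro e hs
    rw [hs] at this
    exact this

theorem ir_lower {n : ℕ} (hn : 0 < n) {σv : ℕ → Option ℕ} (ha : Admissible (F n) σv)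
    {π : List AClause} (h : IRRefutation (F n) ∅ σv π) : 2 ^ n ≤ aSize π := by
  classical
  have hnone : ∀ i < n, σv (4*i+1) = none := by
    intro i hi
    cases e : σv (4*i+1) with
    | none => rfl
    | some y =>
      obtain ⟨τ, -, hf, hg⟩ := ir_found hn ha h (fun _ => false)
      exact absurd rfl ((ir_det ha hf hg i hi).2 y e)
  choose f hf hfun hF using fun a : Fin n → Bool => ir_found hn ha h (asg a)
  have inj : Function.Injective f := by
    intro a a' e
    funext i
    rw [← asg_x a i, ← asg_x a' i, (ir_det ha (hfun a) (hF a) i i.2).1 (hnone i i.2),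
      (ir_det ha (hfun a') (hF a') i i.2).1 (hnone i i.2), e]
  have h2 : (Finset.univ.image f).card = 2 ^ n := by
    rw [Finset.card_image_of_injective _ inj]; simp
  have h4 : Finset.univ.image f ⊆ π.toFinset.biUnion fun E => E.image ALit.ann := by
    intro τ hτ
    obtain ⟨a, -, rfl⟩ := Finset.mem_image.1 hτ
    obtain ⟨E, hE, al, hal, e⟩ := hf a
    exact Finset.mem_biUnion.2 ⟨E, List.mem_toFinset.2 hE, Finset.mem_image.2 ⟨al, hal, e⟩⟩
  calc 2 ^ n = (Finset.univ.image f).card := h2.symm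
    _ ≤ _ := Finset.card_le_card h4
    _ ≤ ∑ E ∈ π.toFinset, (E.image ALit.ann).card := Finset.card_biUnion_le
    _ ≤ ∑ E ∈ π.toFinset, AClause.symSize E := by
      refine Finset.sum_le_sum fun E _ => ?_
      refine Finset.card_image_le.trans ?_
      rw [AClause.symSize, Finset.card_eq_sum_ones]
      exact Finset.sum_le_sum fun al _ => by simp [ALit.symSize]
    _ ≤ aSize π := sum_ge _ _ _ fun a ha => List.mem_toFinset.1 ha

end NE

namespace NE

/-! ### First-order basics -/

theorem FTerm_ind {P : FTerm → Prop} (hv : ∀ x, P (.var x))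
    (ha : ∀ f args, (∀ t ∈ args, P t) → P (.app f args)) : ∀ t, P t
  | .var x => hv x
  | .app f args => ha f args fun t _ht => FTerm_ind hv ha t
termination_by t => sizeOf t
decreasing_by
  have := List.sizeOf_lt_of_mem _ht
  simp only [FTerm.app.sizeOf_spec]; omega

theorem subst_var (σ : ℕ → FTerm) (x : ℕ) : (FTerm.var x).subst σ = σ x := by
  simp [FTerm.subst]

theorem subst_app (σ : ℕ → FTerm) (f : ℕ) (args : List FTerm) :
    (FTerm.app f args).subst σ = .app f (args.map (FTerm.subst σ)) := by
  rw [FTerm.subst]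
  congr 1
  exact List.attach_map_val (l := args) (f := FTerm.subst σ) ▸ rfl

theorem symSize_var (x : ℕ) : (FTerm.var x).symSize = 1 := by
  simp [FTerm.symSize]

theorem symSize_app (f : ℕ) (args : List FTerm) :
    (FTerm.app f args).symSize = 1 + (args.map FTerm.symSize).sum := by
  rw [FTerm.symSize]
  congr 2
  exact List.attach_map_val (l := args) (f := FTerm.symSize) ▸ rfl

theorem mem_foldr_union (L : List (Finset ℕ)) (x : ℕ) :
    x ∈ L.foldr (· ∪ ·) ∅ ↔ ∃ s ∈ L, x ∈ s := by
  induction L with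
  | nil => simp
  | cons a L ih => simp [ih]

theorem mem_vars_var {x y : ℕ} : x ∈ (FTerm.var y).vars ↔ x = y := by
  simp [FTerm.vars]

theorem mem_vars_app {x f : ℕ} {args : List FTerm} :
    x ∈ (FTerm.app f args).vars ↔ ∃ t ∈ args, x ∈ t.vars := by
  rw [FTerm.vars, mem_foldr_union]
  simp

theorem mem_vars_atom {x : ℕ} {a : FAtom} : x ∈ a.vars ↔ ∃ t ∈ a.args, x ∈ t.vars := by
  rw [FAtom.vars, mem_foldr_union]
  simp

theorem mem_fvars {x : ℕ} {C : FClause} : x ∈ C.fvars ↔ ∃ l ∈ C, x ∈ l.atom.vars := by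
  simp [FClause.fvars, Finset.mem_sup]

theorem subst_id_of {σ : ℕ → FTerm} : ∀ t : FTerm, (∀ x ∈ t.vars, σ x = .var x) → t.subst σ = t := by
  refine FTerm_ind ?_ ?_
  · intro x h; rw [subst_var]; exact h x (mem_vars_var.2 rfl)
  · intro f args ih h
    rw [subst_app]
    congr 1
    conv_rhs => rw [← List.map_id args]
    refine List.map_congr_left fun t ht => ?_
    exact ih t ht fun x hx => h x (mem_vars_app.2 ⟨t, ht, hx⟩)

theorem mem_vars_rename {ρ : ℕ → ℕ} : ∀ (t : FTerm) (x : ℕ),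
    x ∈ (t.subst (renameSub ρ)).vars → ∃ y, x = ρ y := by
  refine FTerm_ind ?_ ?_
  · intro y x h
    rw [subst_var, renameSub, mem_vars_var] at h
    exact ⟨y, h⟩
  · intro f args ih x h
    rw [subst_app, mem_vars_app] at h
    obtain ⟨t, ht, hx⟩ := h
    obtain ⟨s, hs, rfl⟩ := List.mem_map.1 ht
    exact ih s hs x hx

theorem disj_rename {R : ℕ} {C D : FClause} (h : ∀ x ∈ C.fvars, x < R) :
    Disjoint C.fvars (FClause.subst (renameSub (· + R)) D).fvars := by
  rw [Finset.disjoint_left]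
  intro x hx hx'
  obtain ⟨l, hl, hxl⟩ := mem_fvars.1 hx'
  obtain ⟨m, hm, rfl⟩ := Finset.mem_image.1 hl
  have hxl : x ∈ (m.atom.subst (renameSub (· + R))).vars := by
    cases m <;> exact hxl
  obtain ⟨t, ht, hxt⟩ := mem_vars_atom.1 hxl
  obtain ⟨s, hs, rfl⟩ := List.mem_map.1 ht
  obtain ⟨y, e⟩ := mem_vars_rename s x hxt
  have := h x hx
  omega

theorem exists_bound (S : Finset ℕ) (N : ℕ) : ∃ R, N ≤ R ∧ ∀ x ∈ S, x < R := by
  refine ⟨S.sup id + N + 1, by omega, fun x hx => ?_⟩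
  have : x ≤ S.sup id := Finset.le_sup (f := id) hx
  omega

theorem mgu_of {σ : ℕ → FTerm} {a b : FAtom} (h1 : a.subst σ = b.subst σ)
    (h2 : ∀ τ, a.subst τ = b.subst τ → ∀ x, (σ x).subst τ = τ x) : IsMGU σ a b :=
  ⟨h1, fun τ h => ⟨τ, h2 τ h⟩⟩

/-- atom `p(f(s 0, …, s (n-1)))` -/
def at_ (n f : ℕ) (s : ℕ → FTerm) : FAtom := ⟨0, [FTerm.app f ((List.range n).map s)]⟩

/-- atom `p(x_i)` -/
def xa (i : ℕ) : FAtom := ⟨0, [FTerm.app (4*i+2) []]⟩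

/-- atom `p(u)`. -/
def ua (x : ℕ) : FAtom := ⟨0, [FTerm.var x]⟩

theorem at_subst (n f : ℕ) (s : ℕ → FTerm) (σ : ℕ → FTerm) :
    (at_ n f s).subst σ = at_ n f (fun j => (s j).subst σ) := by
  simp [at_, FAtom.subst, subst_app, Function.comp_def]

theorem xa_subst (i : ℕ) (σ : ℕ → FTerm) : (xa i).subst σ = xa i := by
  simp [xa, FAtom.subst, subst_app]

theorem ua_subst (x : ℕ) (σ : ℕ → FTerm) : (ua x).subst σ = ⟨0, [σ x]⟩ := by
  simp [ua, FAtom.subst, subst_var]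

theorem at_inj {n f g : ℕ} {s s' : ℕ → FTerm} :
    at_ n f s = at_ n g s' ↔ f = g ∧ ∀ j < n, s j = s' j := by
  simp [at_, List.map_inj_left]

theorem xa_ne_at {n i f : ℕ} {s : ℕ → FTerm} (h : f ≠ 4*i+2) : xa i ≠ at_ n f s := by
  intro e
  simp only [xa, at_, FAtom.mk.injEq, List.cons.injEq, FTerm.app.injEq] at e
  omega

/-! ### The Skolemised clauses -/

/-- the plain variable arguments -/
def uv : ℕ → FTerm := fun j => .var (4*j+1)

theorem univBefore_x {n i : ℕ} (hi : i < n) : (F n).univBefore (4*i) = [] := by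
  simp only [PCNF.univBefore, F, List.flatMap_cons, List.flatMap_nil, List.append_nil]
  rw [List.filterMap_eq_nil_iff]
  rintro ⟨b, x⟩ hx
  have key : ∀ (L : List (Bool × ℕ)) (L' : List (Bool × ℕ)), (∃ p ∈ L, p.2 = 4*i) →
      (∀ p ∈ L, p.1 = true) →
      ∀ p ∈ (L ++ L').takeWhile (fun p => decide (p.2 ≠ 4*i)), p.1 = true := by
    intro L
    induction L with
    | nil => intro L' h; simp at h
    | cons a L ih =>
      intro L' h1 h2 p hp
      rw [List.cons_append, List.takeWhile_cons] at hp
      split at hp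
      · rename_i ha
        rcases List.mem_cons.1 hp with rfl | hp
        · exact h2 _ (by simp)
        · refine ih L' ?_ (fun q hq => h2 q (by simp [hq])) p hp
          obtain ⟨q, hq, e⟩ := h1
          rcases List.mem_cons.1 hq with rfl | hq
          · simp [e] at ha
          · exact ⟨q, hq, e⟩
      · simp at hp
  have := key _ _ ⟨(true, 4*i), by simp; exact hi, rfl⟩ (by simp) _ hx
  simp only at this
  simp [this]

theorem univBefore_T {n a : ℕ} (h2 : 2 ≤ a % 4) :
    (F n).univBefore a = (List.range n).map (fun j => 4*j+1) := by
  simp only [PCNF.univBefore, F, List.flatMap_cons, List.flatMap_nil, List.append_nil]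
  rw [List.takeWhile_append_of_pos, List.takeWhile_append_of_pos, List.filterMap_append,
    List.filterMap_append]
  · have h1 : List.filterMap (fun p : Bool × ℕ => if p.1 = false then some p.2 else none)
      (List.map (fun x => (true, x)) (List.map (fun i => 4 * i) (List.range n))) = [] := by
      rw [List.filterMap_eq_nil_iff]
      intro p hp
      obtain ⟨x, -, rfl⟩ := List.mem_map.1 hp
      simp
    have h3 : List.filterMap (fun p : Bool × ℕ => if p.1 = false then some p.2 else none)
      (List.map (fun x => (false, x)) (List.map (fun i => 4 * i + 1) (List.range n))) =
        (List.range n).map (fun j => 4*j+1) := by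
      rw [List.filterMap_map]
      simp
    rw [h1, h3, List.nil_append]
    convert List.append_nil _
    rw [List.filterMap_eq_nil_iff]
    intro p hp
    have := List.takeWhile_subset _ hp
    obtain ⟨x, -, rfl⟩ := List.mem_map.1 this
    simp
  · intro p hp
    obtain ⟨x, hx, rfl⟩ := List.mem_map.1 hp
    rw [mem_m1] at hx
    simp only [ne_eq, decide_not, Bool.not_eq_true', decide_eq_false_iff_not]
    rintro rfl; omega
  · intro p hp
    obtain ⟨x, hx, rfl⟩ := List.mem_map.1 hp
    rw [mem_m0] at hx
    simp only [ne_eq, decide_not, Bool.not_eq_true', decide_eq_false_iff_not]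
    rintro rfl; omega

theorem sk_x {n i : ℕ} (hi : i < n) : skAtom (F n) (4*i) = xa i := by
  rw [skAtom, if_pos (existB_iff.2 (by omega)), univBefore_x hi]; rfl

theorem sk_u {n i : ℕ} : skAtom (F n) (4*i+1) = ua (4*i+1) := by
  rw [skAtom, if_neg (by rw [existB_iff]; omega)]; rfl

theorem sk_t {n i : ℕ} (hi : i < n) : skAtom (F n) (4*i+2) = at_ n (4*i+4) uv := by
  rw [skAtom, if_pos (existB_iff.2 (by omega)), univBefore_T (by omega)]
  simp [at_, uv]

theorem sk_e {n i : ℕ} (hi : i < n) : skAtom (F n) (4*i+3) = at_ n (4*i+5) uv := by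
  rw [skAtom, if_pos (existB_iff.2 (by omega)), univBefore_T (by omega)]
  simp [at_, uv]

theorem mem_sk {n : ℕ} {C : Clause} {D : FClause} (h : C ∈ mat n) (e : skClause (F n) C = D) :
    D ∈ skSet (F n) := by
  left
  exact Finset.mem_coe.2 (Finset.mem_image.2 ⟨C, h, e⟩)

theorem in_a {n i : ℕ} (hi : i < n) : ({FLit.pos (xa i), FLit.neg (ua (4*i+1)),
    FLit.pos (at_ n (4*i+4) uv)} : FClause) ∈ skSet (F n) :=
  mem_sk (mem_mat.2 (Or.inl ⟨i, hi, rfl⟩)) (by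
    simp only [skClause, Finset.image_insert, Finset.image_singleton, skLit, sk_x hi, sk_u, sk_t hi])

theorem in_b {n i : ℕ} (hi : i < n) : ({FLit.neg (xa i), FLit.pos (ua (4*i+1)),
    FLit.pos (at_ n (4*i+4) uv)} : FClause) ∈ skSet (F n) :=
  mem_sk (mem_mat.2 (Or.inr (Or.inl ⟨i, hi, rfl⟩))) (by
    simp only [skClause, Finset.image_insert, Finset.image_singleton, skLit, sk_x hi, sk_u, sk_t hi])

theorem in_c {n i : ℕ} (hi : i < n) : ({FLit.pos (xa i),
    FLit.pos (at_ n (4*i+5) uv)} : FClause) ∈ skSet (F n) :=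
  mem_sk (mem_mat.2 (Or.inr (Or.inr (Or.inl ⟨i, hi, rfl⟩)))) (by
    simp only [skClause, Finset.image_insert, Finset.image_singleton, skLit, sk_x hi, sk_e hi])

theorem in_d {n i : ℕ} (hi : i < n) : ({FLit.neg (xa i),
    FLit.neg (at_ n (4*i+5) uv)} : FClause) ∈ skSet (F n) :=
  mem_sk (mem_mat.2 (Or.inr (Or.inr (Or.inr (Or.inl ⟨i, hi, rfl⟩))))) (by
    simp only [skClause, Finset.image_insert, Finset.image_singleton, skLit, sk_x hi, sk_e hi])

/-- the clause `¬t_k ∨ … ∨ ¬t_{n-1}` with arguments `s` -/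
noncomputable def KC (n k : ℕ) (s : ℕ → FTerm) : FClause :=
  (Finset.Ico k n).image fun i => FLit.neg (at_ n (4*i+4) s)

theorem in_K {n : ℕ} : KC n 0 uv ∈ skSet (F n) :=
  mem_sk (mem_mat.2 (Or.inr (Or.inr (Or.inr (Or.inr rfl))))) (by
    simp only [skClause, KC, Finset.image_image]
    rw [Finset.range_eq_Ico]
    refine Finset.image_congr fun i hi => ?_
    have hi : i < n := by simpa using hi
    simp only [Function.comp, skLit, sk_t hi])

end NE

namespace NE

/-! ### Bookkeeping for tree derivations -/

def Der (S : Set FClause) (B N : ℕ) (C : FClause) : Prop := ∃ t : R1Tree S C, t.size ≤ N * B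

theorem Der.input {S : Set FClause} {B : ℕ} {C : FClause} (h : C ∈ S) (hB : C.symSize ≤ B) :
    Der S B 1 C := ⟨.input C h, by simpa [R1Tree.size] using hB⟩

theorem Der.factor {S : Set FClause} {B N : ℕ} {C D : FClause} (h : Der S B N C)
    (hf : IsFactor C D) (hB : D.symSize ≤ B) : Der S B (N+1) D := by
  obtain ⟨t, ht⟩ := h
  refine ⟨.factor t D hf, ?_⟩
  rw [R1Tree.size, Nat.add_mul]
  omega

theorem Der.res {S : Set FClause} {B N M : ℕ} {C D E : FClause} (h : Der S B N C)
    (h' : Der S B M D) (hf : IsResolvent C D E) (hB : E.symSize ≤ B) : Der S B (N+M+1) E := by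
  obtain ⟨t, ht⟩ := h
  obtain ⟨t', ht'⟩ := h'
  refine ⟨.resolve t t' E hf, ?_⟩
  rw [R1Tree.size, Nat.add_mul, Nat.add_mul]
  omega

def lit (b : Bool) (a : FAtom) : FLit := if b then .pos a else .neg a

theorem lit_subst (b : Bool) (a : FAtom) (σ : ℕ → FTerm) : (lit b a).subst σ = lit b (a.subst σ) := by
  cases b <;> rfl
theorem lit_isPos (b : Bool) (a : FAtom) : (lit b a).isPos = b := by cases b <;> rfl
theorem lit_atom (b : Bool) (a : FAtom) : (lit b a).atom = a := by cases b <;> rfl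
theorem lit_inj {b c : Bool} {a a' : FAtom} : lit b a = lit c a' ↔ b = c ∧ a = a' := by
  cases b <;> cases c <;> simp [lit]

/-- bound on literal sizes -/
def LBd (n : ℕ) : ℕ := n * (n+1) + 3
/-- bound on clause sizes -/
def CBd (n : ℕ) : ℕ := (n+3) * LBd n

theorem size_at {n f : ℕ} {s : ℕ → FTerm} (h : ∀ j < n, (s j).symSize ≤ n+1) (b : Bool) :
    (lit b (at_ n f s)).symSize ≤ LBd n := by
  have h1 : (((List.range n).map s).map FTerm.symSize).sum ≤ n * (n+1) := by
    have := List.sum_le_card_nsmul (((List.range n).map s).map FTerm.symSize) (n+1) (by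
      intro x hx
      simp only [List.map_map, List.mem_map, List.mem_range, Function.comp] at hx
      obtain ⟨j, hj, rfl⟩ := hx
      exact h j hj)
    simpa using this
  have h2 : (at_ n f s).symSize = 1 + (1 + (((List.range n).map s).map FTerm.symSize).sum) := by
    simp only [at_, FAtom.symSize, List.map_cons, List.map_nil, List.sum_cons, List.sum_nil,
      symSize_app, Nat.add_zero]
  unfold LBd
  cases b
  · show 1 + (at_ n f s).symSize ≤ _
    omega
  · show (at_ n f s).symSize ≤ _
    omega

theorem size_xa {n i : ℕ} (b : Bool) : (lit b (xa i)).symSize ≤ LBd n := by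
  have : (xa i).symSize = 2 := by simp [xa, FAtom.symSize, symSize_app]
  unfold LBd
  cases b
  · show 1 + (xa i).symSize ≤ _
    omega
  · show (xa i).symSize ≤ _
    omega

theorem size_ua {n i : ℕ} (b : Bool) : (lit b (ua i)).symSize ≤ LBd n := by
  have : (ua i).symSize = 2 := by simp [ua, FAtom.symSize, symSize_var]
  unfold LBd
  cases b
  · show 1 + (ua i).symSize ≤ _
    omega
  · show (ua i).symSize ≤ _
    omega

theorem size_cl {n : ℕ} {C : FClause} (h : ∀ l ∈ C, l.symSize ≤ LBd n) (hc : C.card ≤ n+3) :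
    C.symSize ≤ CBd n := by
  refine (Finset.sum_le_card_nsmul C _ (LBd n) h).trans ?_
  rw [smul_eq_mul]
  exact Nat.mul_le_mul_right _ hc

theorem size_uv (n : ℕ) : ∀ j < n, (uv j).symSize ≤ n + 1 := fun j _ => by
  rw [uv, symSize_var]; omega

/-- arguments in the instance of `t_i` -/
def ew (n i M : ℕ) : FTerm := .app (4*i+5) ((List.range n).map fun l => FTerm.var (4*l+1+M))
def w (n i M : ℕ) : ℕ → FTerm := fun j => if j = i then ew n i M else .var (4*j+1)

theorem size_ew (n i M : ℕ) : (ew n i M).symSize = n + 1 := by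
  have : ((List.range n).map fun l => FTerm.var (4*l+1+M)).map FTerm.symSize = List.replicate n 1 := by
    rw [List.map_map, List.eq_replicate_iff]
    refine ⟨by simp, ?_⟩
    intro b hb
    obtain ⟨l, -, rfl⟩ := List.mem_map.1 hb
    exact symSize_var _
  rw [ew, symSize_app, this]
  simp [Nat.add_comm]

theorem size_w (n i M : ℕ) : ∀ j < n, (w n i M j).symSize ≤ n + 1 := fun j _ => by
  unfold w
  split
  · rw [size_ew]
  · rw [symSize_var]; omega

theorem er1 {A B T E : FLit} (h1 : A ≠ B) (h2 : T ≠ B) (h3 : A ≠ E) :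
    (({A, B, T} : FClause).erase B) ∪ (({A, E} : FClause).erase E) = {A, T} := by
  ext l
  simp only [Finset.mem_union, Finset.mem_erase, Finset.mem_insert, Finset.mem_singleton]
  grind

theorem er2 {A A' T T' : FLit} (h1 : T ≠ A) (h2 : T' ≠ A') :
    (({A, T} : FClause).erase A) ∪ (({A', T'} : FClause).erase A') = {T, T'} := by
  ext l
  simp only [Finset.mem_union, Finset.mem_erase, Finset.mem_insert, Finset.mem_singleton]
  grind

theorem at_rename (n f M : ℕ) : (at_ n f uv).subst (renameSub (· + M)) =
    at_ n f (fun j => .var (4*j+1+M)) := by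
  rw [at_subst]
  simp [uv, subst_var, renameSub]

theorem step1 {n i M : ℕ} (hi : i < n) (hM : 4*n ≤ M) (b : Bool)
    (hv : ∀ x ∈ FClause.fvars {lit b (xa i), lit (!b) (ua (4*i+1)), lit true (at_ n (4*i+4) uv)}, x < M) :
    IsResolvent {lit b (xa i), lit (!b) (ua (4*i+1)), lit true (at_ n (4*i+4) uv)}
      {lit b (xa i), lit b (at_ n (4*i+5) uv)}
      {lit b (xa i), lit true (at_ n (4*i+4) (w n i M))} := by
  let σ : ℕ → FTerm := fun x => if x = 4*i+1 then ew n i M else .var x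
  have hσ : ∀ j, σ (4*j+1+M) = .var (4*j+1+M) := fun j => if_neg (by omega)
  have hσi : σ (4*i+1) = ew n i M := if_pos rfl
  have hE : (at_ n (4*i+5) (fun j => FTerm.var (4*j+1+M))).subst σ =
      at_ n (4*i+5) (fun j => FTerm.var (4*j+1+M)) := by
    rw [at_subst]; simp only [subst_var, hσ]
  have hU : (ua (4*i+1)).subst σ = at_ n (4*i+5) (fun j => FTerm.var (4*j+1+M)) := by
    rw [ua_subst, hσi]; rfl
  have hT : (at_ n (4*i+4) uv).subst σ = at_ n (4*i+4) (w n i M) := by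
    rw [at_subst]
    congr 1
    funext j
    simp only [uv, subst_var, σ, w]
    by_cases h : j = i
    · subst h; simp
    · rw [if_neg h, if_neg (by omega)]
  refine ⟨(· + M), fun a b h => by simpa using h, lit (!b) (ua (4*i+1)),
    lit b (at_ n (4*i+5) (fun j => .var (4*j+1+M))), σ, disj_rename hv, by simp, ?_, ?_, ?_, ?_⟩
  · refine Finset.mem_image.2 ⟨lit b (at_ n (4*i+5) uv), by simp, ?_⟩
    rw [lit_subst, at_rename]
  · rw [lit_isPos, lit_isPos]
  · rw [lit_atom, lit_atom]
    refine mgu_of (by rw [hU, hE]) ?_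
    intro τ hτ x
    rw [ua_subst, at_subst] at hτ
    by_cases h : x = 4*i+1
    · subst h
      rw [hσi]
      simp only [at_, FAtom.mk.injEq, List.cons.injEq, and_true, true_and, subst_var] at hτ
      rw [hτ, ew, subst_app, List.map_map]
      congr 1
      exact List.map_congr_left fun l _ => by simp [subst_var]
    · simp only [σ, if_neg h, subst_var]
  · simp only [FClause.subst, Finset.image_insert, Finset.image_singleton, lit_subst, at_rename,
      xa_subst, hU, hE, hT]
    rw [er1]
    · rw [Ne, lit_inj]; cases b <;> simp
    · rw [Ne, lit_inj, at_inj]; rintro ⟨-, h, -⟩; omega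
    · rw [Ne, lit_inj]; rintro ⟨-, h⟩; exact xa_ne_at (by omega) h

theorem step2 {n i R : ℕ} {s : ℕ → FTerm}
    (hv : ∀ x ∈ FClause.fvars {lit true (xa i), lit true (at_ n (4*i+4) s)}, x < R) :
    IsResolvent {lit true (xa i), lit true (at_ n (4*i+4) s)}
      {lit false (xa i), lit true (at_ n (4*i+4) s)}
      {lit true (at_ n (4*i+4) s), lit true ((at_ n (4*i+4) s).subst (renameSub (· + R)))} := by
  have hid : ∀ a : FAtom, a.subst FTerm.var = a := by
    rintro ⟨p, args⟩
    simp only [FAtom.subst, FAtom.mk.injEq, true_and]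
    conv_rhs => rw [← List.map_id args]
    exact List.map_congr_left fun t _ => subst_id_of t fun _ _ => rfl
  refine ⟨(· + R), fun a b h => by simpa using h, lit true (xa i), lit false (xa i), FTerm.var,
    disj_rename hv, by simp, ?_, ?_, ?_, ?_⟩
  · refine Finset.mem_image.2 ⟨lit false (xa i), by simp, ?_⟩
    rw [lit_subst, xa_subst]
  · rw [lit_isPos, lit_isPos]; rfl
  · rw [lit_atom, lit_atom]
    exact mgu_of rfl fun τ _ x => subst_var τ x
  · simp only [FClause.subst, Finset.image_insert, Finset.image_singleton, lit_subst, hid, xa_subst]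
    rw [er2]
    · rw [Ne, lit_inj]; rintro ⟨-, h⟩; exact xa_ne_at (by omega) h.symm
    · rw [Ne, lit_inj]; simp

theorem unif_rename {τ : ℕ → FTerm} {ρ : ℕ → ℕ} : ∀ t : FTerm,
    t.subst τ = (t.subst (renameSub ρ)).subst τ → ∀ y ∈ t.vars, τ y = τ (ρ y) := by
  refine FTerm_ind ?_ ?_
  · intro x h y hy
    rw [mem_vars_var] at hy
    subst hy
    simpa [subst_var, renameSub] using h
  · intro f args ih h y hy
    obtain ⟨t, ht, hyt⟩ := mem_vars_app.1 hy
    refine ih t ht ?_ y hyt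
    simp only [subst_app, List.map_map, FTerm.app.injEq, true_and] at h
    exact List.map_inj_left.1 h t ht

theorem unrename {σ : ℕ → FTerm} {ρ : ℕ → ℕ} : ∀ t : FTerm, (∀ y ∈ t.vars, σ (ρ y) = .var y) →
    (t.subst (renameSub ρ)).subst σ = t := by
  refine FTerm_ind ?_ ?_
  · intro x h
    simpa [subst_var, renameSub] using h x (mem_vars_var.2 rfl)
  · intro f args ih h
    simp only [subst_app, List.map_map, FTerm.app.injEq, true_and]
    conv_rhs => rw [← List.map_id args]
    exact List.map_congr_left fun t ht => ih t ht fun y hy => h y (mem_vars_app.2 ⟨t, ht, hy⟩)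

theorem step3 {R : ℕ} {a : FAtom} (hv : ∀ x ∈ a.vars, x < R)
    (hne : a ≠ a.subst (renameSub (· + R))) :
    IsFactor {lit true a, lit true (a.subst (renameSub (· + R)))} {lit true a} := by
  classical
  let σ : ℕ → FTerm := fun x => if R ≤ x ∧ x - R ∈ a.vars then .var (x - R) else .var x
  have h1 : a.subst σ = a := by
    obtain ⟨p, args⟩ := a
    simp only [FAtom.subst, FAtom.mk.injEq, true_and]
    conv_rhs => rw [← List.map_id args]
    refine List.map_congr_left fun t ht => subst_id_of t fun x hx => ?_
    have := hv x (mem_vars_atom.2 ⟨t, ht, hx⟩)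
    exact if_neg (by omega)
  have h2 : (a.subst (renameSub (· + R))).subst σ = a := by
    have : ∀ y ∈ a.vars, σ (y + R) = .var y := fun y hy => by
      have e : R ≤ y + R ∧ y + R - R ∈ a.vars := ⟨by omega, by simpa using hy⟩
      simp only [σ, if_pos e]; simp
    clear_value σ
    obtain ⟨p, args⟩ := a
    simp only [FAtom.subst, FAtom.mk.injEq, true_and, List.map_map]
    conv_rhs => rw [← List.map_id args]
    exact List.map_congr_left fun t ht => unrename t fun y hy => this y (mem_vars_atom.2 ⟨t, ht, hy⟩)
  refine ⟨lit true a, lit true (a.subst (renameSub (· + R))), σ, by simp, by simp, ?_, rfl, ?_, ?_⟩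
  · rw [Ne, lit_inj]; exact fun h => hne h.2
  · rw [lit_atom, lit_atom]
    refine mgu_of (by rw [h1, h2]) fun τ hτ x => ?_
    by_cases h : R ≤ x ∧ x - R ∈ a.vars
    · simp only [σ, if_pos h, subst_var]
      obtain ⟨t, ht, hy⟩ := mem_vars_atom.1 h.2
      simp only [FAtom.subst, FAtom.mk.injEq, true_and, List.map_map] at hτ
      have := unif_rename t (List.map_inj_left.1 hτ t ht) _ hy
      rw [this]
      congr 1
      omega
    · simp only [σ, if_neg h, subst_var]
  · simp only [FClause.subst, Finset.image_insert, Finset.image_singleton, lit_subst, h1, h2]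
    simp

theorem der_unit {n i : ℕ} (hi : i < n) : ∃ M, 4*n ≤ M ∧
    Der (skSet (F n)) (CBd n) 8 {lit true (at_ n (4*i+4) (w n i M))} := by
  obtain ⟨M, hM, hb⟩ := exists_bound
    (FClause.fvars {lit true (xa i), lit (!true) (ua (4*i+1)), lit true (at_ n (4*i+4) uv)} ∪
     FClause.fvars {lit false (xa i), lit (!false) (ua (4*i+1)), lit true (at_ n (4*i+4) uv)}) (4*n)
  obtain ⟨R, hR, hb'⟩ := exists_bound
    (FClause.fvars {lit true (xa i), lit true (at_ n (4*i+4) (w n i M))}) 1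
  have hvar : ∀ x ∈ (at_ n (4*i+4) (w n i M)).vars, x < R := fun x hx =>
    hb' x (mem_fvars.2 ⟨lit true (at_ n (4*i+4) (w n i M)), by simp, by rwa [lit_atom]⟩)
  have c3 : ∀ A B C : FLit, ({A, B, C} : FClause).card ≤ n+3 := fun A B C =>
    Finset.card_le_three.trans (by omega)
  have c2 : ∀ A B : FLit, ({A, B} : FClause).card ≤ n+3 := fun A B =>
    Finset.card_le_two.trans (by omega)
  have sz3 : ∀ b, FClause.symSize {lit b (xa i), lit (!b) (ua (4*i+1)), lit true (at_ n (4*i+4) uv)}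
      ≤ CBd n := fun b => size_cl (by
    simp only [Finset.mem_insert, Finset.mem_singleton]
    rintro l (rfl | rfl | rfl)
    exacts [size_xa _, size_ua _, size_at (size_uv n) _]) (c3 _ _ _)
  have sz2 : ∀ b, FClause.symSize {lit b (xa i), lit b (at_ n (4*i+5) uv)}
      ≤ CBd n := fun b => size_cl (by
    simp only [Finset.mem_insert, Finset.mem_singleton]
    rintro l (rfl | rfl)
    exacts [size_xa _, size_at (size_uv n) _]) (c2 _ _)
  have szr : ∀ b, FClause.symSize {lit b (xa i), lit true (at_ n (4*i+4) (w n i M))}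
      ≤ CBd n := fun b => size_cl (by
    simp only [Finset.mem_insert, Finset.mem_singleton]
    rintro l (rfl | rfl)
    exacts [size_xa _, size_at (size_w n i M) _]) (c2 _ _)
  have d1 := (Der.input (in_a hi) (sz3 true)).res (Der.input (in_c hi) (sz2 true))
    (step1 hi hM true fun x hx => hb x (Finset.mem_union_left _ hx)) (szr true)
  have d2 := (Der.input (in_b hi) (sz3 false)).res (Der.input (in_d hi) (sz2 false))
    (step1 hi hM false fun x hx => hb x (Finset.mem_union_right _ hx)) (szr false)
  have d3 := d1.res d2 (step2 hb') (size_cl (by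
    simp only [Finset.mem_insert, Finset.mem_singleton]
    rintro l (rfl | rfl)
    · exact size_at (size_w n i M) _
    · rw [at_subst]
      refine size_at (fun j hj => ?_) _
      unfold w
      split
      · have := size_ew n i (M+R)
        rw [ew] at this ⊢
        rw [subst_app, List.map_map, ← this.le.antisymm this.ge]
        apply le_of_eq
        congr 2
        refine List.map_congr_left fun l _ => ?_
        simp [subst_var, renameSub, Nat.add_assoc]
      · rw [subst_var, renameSub, symSize_var]; omega) (c2 _ _))
  refine ⟨M, hM, d3.factor (step3 hvar ?_) (size_cl (by
    simp only [Finset.mem_singleton]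
    rintro l rfl
    exact size_at (size_w n i M) _) (by simp))⟩
  rw [at_subst]
  intro e
  have := (at_inj.1 e).2 i hi
  simp only [w, if_true, ew, subst_app, FTerm.app.injEq, true_and, List.map_map] at this
  have := List.map_inj_left.1 this 0 (by simp; omega)
  simp [subst_var, renameSub] at this
  omega

/-- One step of the main chain. -/
theorem chain_step {n k M : ℕ} (hk : k < n) (hM : 4*n ≤ M) {s : ℕ → FTerm}
    (h1 : ∀ j, k ≤ j → j < n → s j = .var (4*j+1))
    (h2 : ∀ j < k, ∀ l, k ≤ l → l < n → 4*l+1 ∉ (s j).vars) :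
    ∃ R, 4*n ≤ R ∧ IsResolvent (KC n k s) {lit true (at_ n (4*k+4) (w n k M))}
      (KC n (k+1) (fun j => if j = k then ew n k R else s j)) := by
  classical
  obtain ⟨R, hR, hb⟩ := exists_bound
    ((KC n k s).fvars ∪ (Finset.range n).sup fun j => (s j).vars) (4*n)
  have hbs : ∀ j < n, ∀ x ∈ (s j).vars, x < R := fun j hj x hx =>
    hb x (Finset.mem_union_right _ (Finset.mem_sup.2 ⟨j, by simpa using hj, hx⟩))
  refine ⟨M+R, by omega, ?_⟩
  let σ : ℕ → FTerm := fun x => if x = 4*k+1 then ew n k (M+R) else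
    if R ≤ x ∧ (x-R) % 4 = 1 ∧ (x-R)/4 < n ∧ (x-R)/4 ≠ k then s ((x-R)/4) else .var x
  have σk : σ (4*k+1) = ew n k (M+R) := if_pos rfl
  have σR : ∀ j < n, j ≠ k → σ (4*j+1+R) = s j := fun j hj hjk => by
    have e : (4*j+1+R-R)/4 = j := by omega
    simp only [σ]
    rw [if_neg (by omega), if_pos (by rw [e]; omega), e]
  have σM : ∀ j, σ (4*j+1+(M+R)) = .var (4*j+1+(M+R)) := fun j => by
    simp only [σ]
    rw [if_neg (by omega), if_neg (by omega)]
  have σs : ∀ j < n, j ≠ k → (s j).subst σ = s j := fun j hj hjk => subst_id_of _ fun x hx => by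
    have hxR := hbs j hj x hx
    have hx1 : x ≠ 4*k+1 := by
      rintro rfl
      rcases lt_or_gt_of_ne hjk with h | h
      · exact h2 j h k le_rfl hk hx
      · rw [h1 j h.le hj, mem_vars_var] at hx
        omega
    simp only [σ]
    rw [if_neg hx1, if_neg (by omega)]
  have σe : (ew n k (M+R)).subst σ = ew n k (M+R) := by
    rw [ew, subst_app, List.map_map]
    congr 1
    exact List.map_congr_left fun l _ => by simp only [Function.comp, subst_var, σM]
  have ewr : (ew n k M).subst (renameSub (· + R)) = ew n k (M+R) := by
    rw [ew, ew, subst_app, List.map_map]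
    congr 1
    exact List.map_congr_left fun l _ => by
      simp only [Function.comp, subst_var, renameSub, Nat.add_assoc]
  have atc : ∀ f (s s' : ℕ → FTerm), (∀ j < n, s j = s' j) → at_ n f s = at_ n f s' :=
    fun f s s' h => at_inj.2 ⟨rfl, h⟩
  have hren : (at_ n (4*k+4) (w n k M)).subst (renameSub (· + R)) =
      at_ n (4*k+4) (fun j => if j = k then ew n k (M+R) else .var (4*j+1+R)) := by
    rw [at_subst]
    refine atc _ _ _ fun j _ => ?_
    unfold w
    split
    · exact ewr
    · rw [subst_var, renameSub]
  have hK : ∀ f, (at_ n f s).subst σ = at_ n f (fun j => if j = k then ew n k (M+R) else s j) := by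
    intro f
    rw [at_subst]
    refine atc _ _ _ fun j hj => ?_
    split
    · rename_i e
      rw [h1 j (by omega) hj, subst_var, e, σk]
    · rename_i e
      exact σs j hj e
  have hD : (at_ n (4*k+4) (fun j => if j = k then ew n k (M+R) else .var (4*j+1+R))).subst σ =
      at_ n (4*k+4) (fun j => if j = k then ew n k (M+R) else s j) := by
    rw [at_subst]
    refine atc _ _ _ fun j hj => ?_
    split
    · exact σe
    · rename_i e
      rw [subst_var, σR j hj e]
  refine ⟨(· + R), fun a b h => by simpa using h, lit false (at_ n (4*k+4) s),
    lit true (at_ n (4*k+4) (fun j => if j = k then ew n k (M+R) else .var (4*j+1+R))), σ,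
    disj_rename fun x hx => hb x (Finset.mem_union_left _ hx), ?_, ?_, ?_, ?_, ?_⟩
  · exact Finset.mem_image.2 ⟨k, by simp; omega, rfl⟩
  · exact Finset.mem_image.2 ⟨lit true (at_ n (4*k+4) (w n k M)), by simp, by rw [lit_subst, hren]⟩
  · rw [lit_isPos, lit_isPos]; rfl
  · rw [lit_atom, lit_atom]
    refine mgu_of (by rw [hK, hD]) fun τ hτ x => ?_
    rw [at_subst, at_subst, at_inj] at hτ
    have hτ := hτ.2
    by_cases hx : x = 4*k+1
    · subst hx
      have := hτ k hk
      rw [h1 k le_rfl hk, subst_var, if_pos rfl] at this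
      rw [σk, this]
    · by_cases hx2 : R ≤ x ∧ (x-R) % 4 = 1 ∧ (x-R)/4 < n ∧ (x-R)/4 ≠ k
      · have := hτ ((x-R)/4) hx2.2.2.1
        rw [if_neg hx2.2.2.2, subst_var] at this
        simp only [σ]
        rw [if_neg hx, if_pos hx2, this]
        congr 1
        omega
      · simp only [σ]
        rw [if_neg hx, if_neg hx2, subst_var]
  · have e1 : FClause.subst σ (KC n k s) =
        KC n k (fun j => if j = k then ew n k (M+R) else s j) := by
      unfold KC FClause.subst
      rw [Finset.image_image]
      refine Finset.image_congr fun i _ => ?_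
      show FLit.neg ((at_ n (4*i+4) s).subst σ) = _
      rw [hK]
    have e2 : FClause.subst σ (FClause.subst (renameSub (· + R))
        {lit true (at_ n (4*k+4) (w n k M))}) =
        {lit true (at_ n (4*k+4) (fun j => if j = k then ew n k (M+R) else s j))} := by
      simp only [FClause.subst, Finset.image_singleton, lit_subst, hren, hD]
    rw [e1, e2, lit_subst, lit_subst, hK, hD, Finset.erase_singleton, Finset.union_empty]
    unfold KC
    ext l
    simp only [Finset.mem_image, Finset.mem_erase, Finset.mem_Ico]
    constructor
    · rintro ⟨i, hi, rfl⟩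
      refine ⟨?_, i, by omega, rfl⟩
      intro e
      have := (lit_inj (b := false) (c := false)).1 e
      have := (at_inj.1 this.2).1
      omega
    · rintro ⟨hne, i, hi, rfl⟩
      refine ⟨i, ⟨?_, hi.2⟩, rfl⟩
      rcases Nat.lt_or_ge k i with h | h
      · exact h
      · exact absurd (by rw [show i = k by omega]; rfl) hne

theorem chain {n : ℕ} : ∀ k ≤ n, ∃ s : ℕ → FTerm,
    (∀ j, k ≤ j → j < n → s j = .var (4*j+1)) ∧
    (∀ j < k, ∀ l, k ≤ l → l < n → 4*l+1 ∉ (s j).vars) ∧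
    (∀ j < n, (s j).symSize ≤ n+1) ∧
    Der (skSet (F n)) (CBd n) (9*k+1) (KC n k s) := by
  have szK : ∀ k (s : ℕ → FTerm), (∀ j < n, (s j).symSize ≤ n+1) → (KC n k s).symSize ≤ CBd n := by
    intro k s hs
    refine size_cl ?_ (Finset.card_image_le.trans (by simp; omega))
    intro l hl
    obtain ⟨i, -, rfl⟩ := Finset.mem_image.1 hl
    exact size_at hs false
  intro k
  induction k with
  | zero =>
    intro _
    exact ⟨uv, fun _ _ _ => rfl, fun j hj => by omega, size_uv n,
      Der.input in_K (szK _ _ (size_uv n))⟩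
  | succ k ih =>
    intro hk
    obtain ⟨s, h1, h2, h3, h4⟩ := ih (by omega)
    obtain ⟨M, hM, hu⟩ := der_unit (n := n) (i := k) (by omega)
    obtain ⟨R, hR, hr⟩ := chain_step (by omega) hM h1 h2
    have h3' : ∀ j < n, ((fun j => if j = k then ew n k R else s j) j).symSize ≤ n+1 := by
      intro j hj
      simp only
      split
      · rw [size_ew]
      · exact h3 j hj
    refine ⟨_, ?_, ?_, h3', ?_⟩
    · intro j hj hjn
      rw [if_neg (by omega), h1 j (by omega) hjn]
    · intro j hj l hl hln
      split
      · rw [ew, mem_vars_app]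
        rintro ⟨t, ht, hx⟩
        obtain ⟨m, -, rfl⟩ := List.mem_map.1 ht
        rw [mem_vars_var] at hx
        omega
      · exact h2 j (by omega) l (by omega) hln
    · have := h4.res hu hr (szK _ _ h3')
      rwa [show 9*k+1+8+1 = 9*(k+1)+1 by ring] at this

theorem upper (n : ℕ) : ∃ t : R1Tree (skSet (F n)) ∅, t.size ≤ (9*n+1) * CBd n := by
  obtain ⟨s, -, -, -, h⟩ := chain n le_rfl
  have : KC n n s = ∅ := by simp [KC]
  rw [this] at h
  exact h

/-! ### Conclusion -/

theorem no_poly (q : Polynomial ℕ) (h : ∀ n, 0 < n → ∃ m, m ≤ (9*n+1) * CBd n ∧ 2^n ≤ q.eval m) :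
    False := by
  have mono : ∀ a b : ℕ, a ≤ b → q.eval a ≤ q.eval b := by
    intro a b hab
    rw [Polynomial.eval_eq_sum, Polynomial.eval_eq_sum, Polynomial.sum, Polynomial.sum]
    exact Finset.sum_le_sum fun i _ => Nat.mul_le_mul_left _ (Nat.pow_le_pow_left hab i)
  let P : Polynomial ℕ := q.comp ((9 * Polynomial.X + 1) *
    ((Polynomial.X + 3) * (Polynomial.X * (Polynomial.X + 1) + 3)))
  have hP : ∀ n, 0 < n → 2^n ≤ P.eval n := by
    intro n hn
    obtain ⟨m, hm, hq⟩ := h n hn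
    refine hq.trans ((mono _ _ hm).trans (le_of_eq ?_))
    simp [P, CBd, LBd, Polynomial.eval_comp]
  have hlt : ∃ d c : ℕ, ∀ n, 0 < n → P.eval n ≤ c * n ^ d := by
    refine ⟨P.natDegree, ∑ i ∈ P.support, P.coeff i, fun n hn => ?_⟩
    rw [Polynomial.eval_eq_sum, Polynomial.sum, Finset.sum_mul]
    refine Finset.sum_le_sum fun i hi => Nat.mul_le_mul_left _ ?_
    exact Nat.pow_le_pow_right hn (Polynomial.le_natDegree_of_mem_supp i hi)
  obtain ⟨d, c, hdc⟩ := hlt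
  have ht := tendsto_pow_const_div_const_pow_of_one_lt d (r := (2:ℝ)) (by norm_num)
  have hev := ht.eventually (gt_mem_nhds (show (0:ℝ) < 1 / (c + 1) by positivity))
  obtain ⟨n, hn, hn0⟩ := (hev.and (Filter.eventually_gt_atTop 0)).exists
  have h3 : (2:ℝ)^n ≤ c * (n:ℝ)^d := by
    exact_mod_cast (hP n hn0).trans (hdc n hn0)
  have h2 : (0:ℝ) < 2^n := by positivity
  have hc : (0:ℝ) < (c:ℝ) + 1 := by positivity
  rw [div_lt_div_iff₀ h2 hc] at hn
  have : (0:ℝ) ≤ (n:ℝ)^d := by positivity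
  nlinarith

end NE

/-- none of Q-res, QU-res, IR-calc, IR-calc^{σ_v}
polynomially simulates tree R1 + Sk. -/
theorem qbf_calculi_cannot_psimulate_tree_r1_sk :
    (¬ ∃ q : Polynomial ℕ, ∀ Φ : PCNF, Φ.WF → Φ.Closed → ¬ Φ.IsTrue →
        ∀ t : R1Tree (skSet Φ) ∅, ∃ π : List Clause,
          QRefutation Φ false π ∧ qSize π ≤ q.eval t.size) ∧
    (¬ ∃ q : Polynomial ℕ, ∀ Φ : PCNF, Φ.WF → Φ.Closed → ¬ Φ.IsTrue →
        ∀ t : R1Tree (skSet Φ) ∅, ∃ π : List Clause,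
          QRefutation Φ true π ∧ qSize π ≤ q.eval t.size) ∧
    (¬ ∃ q : Polynomial ℕ, ∀ Φ : PCNF, Φ.WF → Φ.Closed → ¬ Φ.IsTrue →
        ∀ t : R1Tree (skSet Φ) ∅, ∃ π : List AClause,
          IRRefutation Φ ∅ noSub π ∧ aSize π ≤ q.eval t.size) ∧
    (¬ ∃ q : Polynomial ℕ, ∀ Φ : PCNF, Φ.WF → Φ.Closed → ¬ Φ.IsTrue →
        ∀ t : R1Tree (skSet Φ) ∅, ∃ σv : ℕ → Option ℕ, Admissible Φ σv ∧
          ∃ π : List AClause, IRRefutation Φ ∅ σv π ∧ aSize π ≤ q.eval t.size) := by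
  refine ⟨?_, ?_, ?_, ?_⟩
  · rintro ⟨q, hq⟩
    refine NE.no_poly q fun n hn => ?_
    obtain ⟨t, ht⟩ := NE.upper n
    obtain ⟨π, hπ, hs⟩ := hq (NE.F n) (NE.wf hn) (NE.closed n) NE.not_true t
    exact ⟨t.size, ht, (NE.q_lower hn hπ).trans hs⟩
  · rintro ⟨q, hq⟩
    refine NE.no_poly q fun n hn => ?_
    obtain ⟨t, ht⟩ := NE.upper n
    obtain ⟨π, hπ, hs⟩ := hq (NE.F n) (NE.wf hn) (NE.closed n) NE.not_true t
    exact ⟨t.size, ht, (NE.q_lower hn hπ).trans hs⟩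
  · rintro ⟨q, hq⟩
    refine NE.no_poly q fun n hn => ?_
    obtain ⟨t, ht⟩ := NE.upper n
    obtain ⟨π, hπ, hs⟩ := hq (NE.F n) (NE.wf hn) (NE.closed n) NE.not_true t
    exact ⟨t.size, ht, (NE.ir_lower hn (σv := noSub) (fun x e h => by simp [noSub] at h) hπ).trans hs⟩
  · rintro ⟨q, hq⟩
    refine NE.no_poly q fun n hn => ?_
    obtain ⟨t, ht⟩ := NE.upper n
    obtain ⟨σv, ha, π, hπ, hs⟩ := hq (NE.F n) (NE.wf hn) (NE.closed n) NE.not_true t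
    exact ⟨t.size, ht, (NE.ir_lower hn ha hπ).trans hs⟩
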